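/- Let G be a finite metric graph, let B be a set of vertices of G containing all boundary vertices and all proper core vertices of G, and let λ > 0 satisfy β₁(G_λ) > β₀^odd(G_λ). Then λ is an eigenvalue of −Δ_G, and dim ker(−Δ_G − λ) = rank Res_λ M_B + β₁(G_λ) − β₀^odd(G_λ). In particular, λ is a pole of M_B if and only if dim ker(−Δ_G − λ) > β₁(G_λ) − β₀^odd(G_λ). -/

import Mathlib

open Real Set Filter Topology

noncomputable section

/-- A finite metric graph: finite vertex and edge sets, each edge `e` has an initial
vertex `o e`, a terminal vertex `t e` and a positive length `L e`, and is identified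
with the interval `[0, L e]`.  Every vertex is an endpoint of some edge. -/
structure MetricGraph where
  V : Type
  E : Type
  [fintV : Fintype V]
  [fintE : Fintype E]
  [decV : DecidableEq V]
  [decE : DecidableEq E]
  o : E → V
  t : E → V
  L : E → ℝ
  L_pos : ∀ e, 0 < L e
  noIsolated : ∀ v, ∃ e, o e = v ∨ t e = v

attribute [instance] MetricGraph.fintV MetricGraph.fintE MetricGraph.decV MetricGraph.decE

namespace MetricGraph

variable (G : MetricGraph)

/-- The source vertex of edge `e` traversed in direction `d`. -/
def esrc (e : G.E) (d : Bool) : G.V := if d then G.o e else G.t e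

/-- The destination vertex of edge `e` traversed in direction `d`. -/
def edst (e : G.E) (d : Bool) : G.V := if d then G.t e else G.o e

/-- A cycle in a metric graph: a closed walk which uses no edge twice and repeats no
vertex except that its initial and terminal vertices coincide. -/
structure Cycle where
  n : ℕ
  npos : 0 < n
  edge : Fin n → G.E
  dir : Fin n → Bool
  edge_inj : Function.Injective edge
  vert_inj : Function.Injective fun i => G.esrc (edge i) (dir i)
  chain : ∀ i : Fin n,
    G.edst (edge i) (dir i) =
      G.esrc (edge ⟨((i : ℕ) + 1) % n, Nat.mod_lt _ npos⟩)
        (dir ⟨((i : ℕ) + 1) % n, Nat.mod_lt _ npos⟩)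

/-- The length of a cycle: the sum of the lengths of its edges. -/
def Cycle.length {G : MetricGraph} (c : G.Cycle) : ℝ := ∑ i, G.L (c.edge i)

/-- The cycle `c` lies in the subgraph given by the edge set `S`. -/
def Cycle.inSub {G : MetricGraph} (c : G.Cycle) (S : Set G.E) : Prop := ∀ i, c.edge i ∈ S

/-- The cycle `c` has odd length with respect to `x`: its length is an odd multiple of `x`. -/
def Cycle.oddLength {G : MetricGraph} (c : G.Cycle) (x : ℝ) : Prop :=
  ∃ m : ℕ, Odd m ∧ c.length = m * x

/-- The initial vertex of a cycle. -/
def Cycle.start {G : MetricGraph} (c : G.Cycle) : G.V :=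
  G.esrc (c.edge ⟨0, c.npos⟩) (c.dir ⟨0, c.npos⟩)

/-- The vertices incident to an edge of the edge set `S`, i.e. the vertex set of the
subgraph generated by `S`. -/
def incVerts (S : Set G.E) : Set G.V := {v | ∃ e ∈ S, G.o e = v ∨ G.t e = v}

/-- Two vertices are related iff they are connected through edges of `S`. -/
def connRel (S : Set G.E) : G.V → G.V → Prop :=
  Relation.EqvGen fun v w => ∃ e ∈ S, G.o e = v ∧ G.t e = w

/-- The connected component of the vertex `v` in the subgraph given by `S`. -/
def component (S : Set G.E) (v : G.V) : Set G.V := {w | G.connRel S v w}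

/-- The number of connected components of the subgraph given by the edge set `S`. -/
def beta0 (S : Set G.E) : ℕ := (G.component S '' G.incVerts S).ncard

/-- The first Betti number `|E| - |V| + β₀` of the subgraph given by the edge set `S`. -/
def beta1 (S : Set G.E) : ℤ :=
  (S.ncard : ℤ) - ((G.incVerts S).ncard : ℤ) + (G.beta0 S : ℤ)

/-- The number of connected components of the subgraph given by `S` which contain a
cycle of odd length with respect to `x`. -/
def beta0odd (S : Set G.E) (x : ℝ) : ℕ :=
  (G.component S '' {v | v ∈ G.incVerts S ∧
    ∃ c : G.Cycle, c.inSub S ∧ c.oddLength x ∧ G.connRel S v c.start}).ncard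

/-- The edge set of the subgraph `G_λ`: all edges whose length is a positive integer
multiple of `π / √λ`. -/
def lamEdges (lam : ℝ) : Set G.E :=
  {e | ∃ k : ℕ, 0 < k ∧ G.L e = k * (π / Real.sqrt lam)}

/-- An edgewise given function is continuous at all the vertices of `G`. -/
def ContVert (f : G.E → ℝ → ℂ) : Prop :=
  (∀ e₁ e₂, G.o e₁ = G.o e₂ → f e₁ 0 = f e₂ 0) ∧
  (∀ e₁ e₂, G.o e₁ = G.t e₂ → f e₁ 0 = f e₂ (G.L e₂)) ∧
  (∀ e₁ e₂, G.t e₁ = G.t e₂ → f e₁ (G.L e₁) = f e₂ (G.L e₂))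

/-- The value of an (edgewise given, vertex-continuous) function at the vertex `v`. -/
def vtxVal (f : G.E → ℝ → ℂ) (v : G.V) : ℂ :=
  if h : ∃ e, G.o e = v then f h.choose 0
  else f (G.noIsolated v).choose (G.L ((G.noIsolated v).choose))

/-- `∂_ν f (v)`: the sum of the derivatives at the vertex `v` of the restrictions of
`f` to the edges incident to `v`, all pointing towards `v`. -/
def normDer (f : G.E → ℝ → ℂ) (v : G.V) : ℂ :=
  (∑ e ∈ Finset.univ.filter fun e => G.t e = v, deriv (f e) (G.L e)) -
    ∑ e ∈ Finset.univ.filter fun e => G.o e = v, deriv (f e) 0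

/-- `f` solves `-f'' = μ f` on every edge and is continuous at the vertices.
(A solution of `-f'' = μ f` on `[0, L e]` is identified with its unique extension to a
global solution on `ℝ`.) -/
def IsSol (mu : ℂ) (f : G.E → ℝ → ℂ) : Prop :=
  (∀ e, ContDiff ℝ 2 (f e)) ∧
  (∀ e, ∀ x : ℝ, deriv (deriv (f e)) x = -mu * f e x) ∧ G.ContVert f

/-- Membership in `ker (-Δ_G - λ)` for the Kirchhoff Laplacian `-Δ_G`. -/
def InKer (lam : ℝ) (f : G.E → ℝ → ℂ) : Prop :=
  G.IsSol (lam : ℂ) f ∧ ∀ v, G.normDer f v = 0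

/-- `ker (-Δ_G - λ)` as a set of (edgewise given) functions. -/
def kerSet (lam : ℝ) : Set (G.E → ℝ → ℂ) := {f | G.InKer lam f}

/-- `λ` is an eigenvalue of the Kirchhoff Laplacian `-Δ_G`. -/
def IsEigenvalue (lam : ℝ) : Prop := G.kerSet lam ≠ {0}

/-- `dim ker (-Δ_G - λ)`. -/
def dimKer (lam : ℝ) : ℕ := Module.finrank ℂ (Submodule.span ℂ (G.kerSet lam))

/-- The resonance eigenspace `R (G, λ)`: all elements of `ker (-Δ_G - λ)` vanishing at
every vertex of `G`. -/
def resSet (lam : ℝ) : Set (G.E → ℝ → ℂ) :=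
  {f | G.InKer lam f ∧ ∀ e, f e 0 = 0 ∧ f e (G.L e) = 0}

/-- `λ` is a (real) resonance of `G` iff `R (G, λ) ≠ {0}`. -/
def IsResonance (lam : ℝ) : Prop := G.resSet lam ≠ {0}

/-- `dim R (G, λ)`. -/
def dimRes (lam : ℝ) : ℕ := Module.finrank ℂ (Submodule.span ℂ (G.resSet lam))

/-- `R_B (G, λ)`: all elements of `ker (-Δ_G - λ)` vanishing at every vertex in `B`. -/
def resSetB (B : Set G.V) (lam : ℝ) : Set (G.E → ℝ → ℂ) :=
  {f | G.InKer lam f ∧ ∀ e, (G.o e ∈ B → f e 0 = 0) ∧ (G.t e ∈ B → f e (G.L e) = 0)}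

/-- `dim R_B (G, λ)`. -/
def dimResB (B : Set G.V) (lam : ℝ) : ℕ :=
  Module.finrank ℂ (Submodule.span ℂ (G.resSetB B lam))

/-- The degree of a vertex (a loop counts twice). -/
def degree (v : G.V) : ℕ := {e | G.o e = v}.ncard + {e | G.t e = v}.ncard

/-- The degree of a vertex inside the subgraph given by the edge set `S`. -/
def degreeIn (S : Set G.E) (v : G.V) : ℕ :=
  {e | e ∈ S ∧ G.o e = v}.ncard + {e | e ∈ S ∧ G.t e = v}.ncard

/-- The edge set of the core of `G`: the largest subgraph without vertices of degree one. -/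
def coreEdges : Set G.E := ⋃₀ {S : Set G.E | ∀ v, G.degreeIn S v ≠ 1}

/-- A boundary vertex is a vertex of degree one. -/
def IsBoundaryVertex (v : G.V) : Prop := G.degree v = 1

/-- A proper core vertex: all edges attached to it belong to the core of `G`. -/
def IsProperCoreVertex (v : G.V) : Prop :=
  ∀ e, G.o e = v ∨ G.t e = v → e ∈ G.coreEdges

/-- The defining property of the function `f^{(l)}` for the Titchmarsh--Weyl matrix:
`f` solves `-f'' = μ f` edgewise, is continuous at the vertices, and satisfies
`∂_ν f (v₀) = 1` and `∂_ν f (v) = 0` for all vertices `v ≠ v₀`. -/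
def IsTWsol (mu : ℂ) (v0 : G.V) (f : G.E → ℝ → ℂ) : Prop :=
  G.IsSol mu f ∧ G.normDer f v0 = 1 ∧ ∀ v, v ≠ v0 → G.normDer f v = 0

open scoped Classical in
/-- The Titchmarsh--Weyl matrix `M_B (μ)` with entries `(M_B (μ))_{k,l} = f^{(l)} (v_k)`
(defined via choice; junk if no `f^{(l)}` exists, i.e. at the eigenvalues). -/
def TW (B : Finset G.V) (mu : ℂ) : Matrix B B ℂ :=
  Matrix.of fun k l : B => if h : ∃ f, G.IsTWsol mu l f then G.vtxVal h.choose k else 0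

/-- The cycle `c` has commensurate edges: all ratios of edge lengths are rational. -/
def Commensurate (c : G.Cycle) : Prop :=
  ∀ i j, ∃ q : ℚ, G.L (c.edge i) = q * G.L (c.edge j)

/-- `u_C`: the maximal number such that the length of each edge of the cycle `c` is a
positive integer multiple of it. -/
def uC (c : G.Cycle) : ℝ :=
  sSup {u : ℝ | 0 < u ∧ ∀ i, ∃ k : ℕ, 0 < k ∧ G.L (c.edge i) = k * u}

/-- `λ_G := inf { π²/u_C² : C a cycle in G with commensurate edges }`, with value `+∞`
if there is no cycle with commensurate edges. -/
def lamThreshold : EReal :=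
  sInf {x : EReal | ∃ c : G.Cycle, G.Commensurate c ∧ x = ((π ^ 2 / (G.uC c) ^ 2 : ℝ) : EReal)}

end MetricGraph

section MatrixFun

variable {m : Type} [Fintype m]

/-- The matrix function `M` has a pole of order `n` at `λ`:
`lim_{z → λ} (z - λ)^n M(z)` exists and is nonzero, while
`lim_{z → λ} (z - λ)^(n+1) M(z) = 0`. -/
def hasPoleOrder (M : ℂ → Matrix m m ℂ) (lam : ℂ) (n : ℕ) : Prop :=
  (∃ A : Matrix m m ℂ, A ≠ 0 ∧
    Filter.Tendsto (fun z => (z - lam) ^ n • M z) (𝓝[≠] lam) (𝓝 A)) ∧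
  Filter.Tendsto (fun z => (z - lam) ^ (n + 1) • M z) (𝓝[≠] lam) (𝓝 0)

/-- `λ` is a pole of the matrix function `M`: `M` is analytic on a punctured
neighborhood of `λ` and has a pole of some order `n ≥ 1` at `λ`. -/
def isPole (M : ℂ → Matrix m m ℂ) (lam : ℂ) : Prop :=
  (∀ᶠ z in 𝓝[≠] lam, ∀ k l, AnalyticAt ℂ (fun w => M w k l) z) ∧
  ∃ n : ℕ, 1 ≤ n ∧ hasPoleOrder M lam n

open scoped Classical in
/-- `Res_λ M := (2πi)⁻¹ ∮_Γ M(μ) dμ`, computed entrywise over a sufficiently small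
positively oriented circle `Γ` centered at `λ` (defined via choice as the common value
of the circle integrals over all sufficiently small radii). -/
def matResidue (M : ℂ → Matrix m m ℂ) (lam : ℂ) : Matrix m m ℂ :=
  Matrix.of fun k l =>
    if h : ∃ c : ℂ, ∀ᶠ R in 𝓝[>] (0 : ℝ),
        (2 * (π : ℂ) * Complex.I)⁻¹ * circleIntegral (fun z => M z k l) lam R = c
    then h.choose else 0

end MatrixFun

section SimplePole

open scoped Matrix

variable {n : Type*} [Fintype n] [DecidableEq n]

theorem analyticAt_matrix_det {S : ℂ → Matrix n n ℂ} {z : ℂ}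
    (hS : ∀ i j, AnalyticAt ℂ (fun w => S w i j) z) : AnalyticAt ℂ (fun w => (S w).det) z := by
  simp only [Matrix.det_apply']
  refine Finset.analyticAt_fun_sum _ fun p _ => analyticAt_const.mul ?_
  exact Finset.analyticAt_fun_prod _ fun i _ => hS _ _

theorem analyticAt_matrix_inv {S : ℂ → Matrix n n ℂ} {z : ℂ}
    (hS : ∀ i j, AnalyticAt ℂ (fun w => S w i j) z) (hz : (S z).det ≠ 0) (i j : n) :
    AnalyticAt ℂ (fun w => (S w)⁻¹ i j) z := by
  have h : (fun w => (S w)⁻¹ i j) = fun w => (S w).det⁻¹ * (S w).adjugate i j := by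
    funext w
    rw [Matrix.inv_def, Matrix.smul_apply, Ring.inverse_eq_inv', smul_eq_mul]
  rw [h]
  refine ((analyticAt_matrix_det hS).inv hz).mul ?_
  simp only [Matrix.adjugate_apply]
  refine analyticAt_matrix_det fun k l => ?_
  by_cases hk : k = j
  · subst hk
    simp only [Matrix.updateRow_self]
    exact analyticAt_const
  · simp only [Matrix.updateRow_ne hk]
    exact hS k l

theorem AnalyticAt.dslope_same {f : ℂ → ℂ} {a : ℂ} (hf : AnalyticAt ℂ f a) :
    AnalyticAt ℂ (dslope f a) a := by
  obtain ⟨p, hp⟩ := hf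
  exact ⟨_, hp.has_fpower_series_dslope_fslope⟩

theorem exists_matrix_proj_ker (A : Matrix n n ℂ) :
    ∃ Q : Matrix n n ℂ, A * Q = 0 ∧ ∀ x, A *ᵥ x = 0 → Q *ᵥ x = x := by
  obtain ⟨p, hp⟩ := LinearMap.exists_leftInverse_of_injective
    (LinearMap.ker A.mulVecLin).subtype (Submodule.ker_subtype _)
  refine ⟨LinearMap.toMatrix' ((LinearMap.ker A.mulVecLin).subtype ∘ₗ p), ?_, ?_⟩
  · apply Matrix.toLin'.injective
    ext1 i
    ext1
    simp only [Matrix.toLin'_mul, Matrix.toLin'_toMatrix', LinearMap.comp_apply, map_zero,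
      LinearMap.zero_apply]
    exact LinearMap.mem_ker.1 (p ((LinearMap.single ℂ (fun _ => ℂ) i) 1)).2
  · intro x hx
    rw [LinearMap.toMatrix'_mulVec]
    have := LinearMap.congr_fun hp ⟨x, by simpa using hx⟩
    simp only [LinearMap.comp_apply, LinearMap.id_apply] at this
    simpa using congrArg Subtype.val this

/-- An analytic matrix family `T` whose derivative at `a` maps the kernel of `T a`
injectively into the cokernel of `T a` has an inverse with a simple pole at `a`. -/
theorem exists_simplePole_inverse {T : ℂ → Matrix n n ℂ} {a : ℂ}
    (hT : ∀ i j, AnalyticAt ℂ (fun z => T z i j) a) (T' : Matrix n n ℂ)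
    (hT' : ∀ i j, HasDerivAt (fun z => T z i j) (T' i j) a)
    (hnd : ∀ x y, T a *ᵥ x = 0 → T' *ᵥ x = T a *ᵥ y → x = 0) :
    ∃ (R : Matrix n n ℂ) (H : ℂ → Matrix n n ℂ),
      (∀ i j, AnalyticAt ℂ (fun z => H z i j) a) ∧
      (∀ᶠ z in 𝓝[≠] a, (T z).det ≠ 0 ∧ (T z)⁻¹ = (z - a)⁻¹ • R + H z) ∧
      ∀ w, T a *ᵥ (R *ᵥ w) = 0 ∧ ∃ y, w = T a *ᵥ y + T' *ᵥ (R *ᵥ w) := by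
  obtain ⟨Q, hAQ, hQ⟩ := exists_matrix_proj_ker (T a)
  set D : ℂ → Matrix n n ℂ := fun z => Matrix.of fun i j => dslope (fun z => T z i j) a z with hD
  set S : ℂ → Matrix n n ℂ := fun z => T z * (1 - Q) + D z * Q with hSdef
  have hDa : D a = T' := by
    ext i j
    simp [hD, (hT' i j).deriv]
  have hSan : ∀ i j, AnalyticAt ℂ (fun z => S z i j) a := by
    intro i j
    simp only [hSdef, Matrix.add_apply, Matrix.mul_apply]
    refine AnalyticAt.fun_add ?_ ?_
    · exact Finset.analyticAt_fun_sum _ fun k _ => (hT i k).mul analyticAt_const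
    · refine Finset.analyticAt_fun_sum _ fun k _ => AnalyticAt.mul ?_ analyticAt_const
      simpa [hD] using (hT i k).dslope_same
  have hSa : (S a).det ≠ 0 := by
    intro h0
    obtain ⟨x, hx0, hx⟩ := Matrix.exists_mulVec_eq_zero_iff.2 h0
    apply hx0
    have h1 : T a *ᵥ x + T' *ᵥ (Q *ᵥ x) = 0 := by
      have : S a *ᵥ x = T a *ᵥ x + T' *ᵥ (Q *ᵥ x) := by
        simp [hSdef, hDa, Matrix.add_mulVec, mul_sub, hAQ, Matrix.mulVec_mulVec]
      rw [← this, hx]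
    have h2 : Q *ᵥ x = 0 := by
      refine hnd _ (-x) ?_ ?_
      · rw [Matrix.mulVec_mulVec, hAQ, Matrix.zero_mulVec]
      · rw [Matrix.mulVec_neg]
        exact eq_neg_of_add_eq_zero_right h1
    rw [h2, Matrix.mulVec_zero, add_zero] at h1
    rw [← hQ x h1, h2]
  have hev : ∀ᶠ z in 𝓝[≠] a, (S z).det ≠ 0 :=
    ((analyticAt_matrix_det hSan).continuousAt.eventually_ne hSa).filter_mono nhdsWithin_le_nhds
  set I : ℂ → Matrix n n ℂ := fun z => Matrix.of fun i j => dslope (fun z => (S z)⁻¹ i j) a z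
    with hI
  refine ⟨Q * (S a)⁻¹, fun z => (1 - Q) * (S z)⁻¹ + Q * I z, ?_, ?_, ?_⟩
  · intro i j
    simp only [Matrix.add_apply, Matrix.mul_apply]
    have hinv := analyticAt_matrix_inv hSan hSa
    refine AnalyticAt.fun_add ?_ ?_
    · exact Finset.analyticAt_fun_sum _ fun k _ => analyticAt_const.mul (hinv k j)
    · refine Finset.analyticAt_fun_sum _ fun k _ => analyticAt_const.mul ?_
      simpa [hI] using (hinv k j).dslope_same
  · filter_upwards [hev, self_mem_nhdsWithin] with z hz hza
    have hza' : z - a ≠ 0 := sub_ne_zero.2 hza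
    have hDz : D z = (z - a)⁻¹ • (T z - T a) := by
      ext i j
      simp [hD, dslope_of_ne _ hza, slope_def_field, div_eq_inv_mul]
    have hIz : I z = (z - a)⁻¹ • ((S z)⁻¹ - (S a)⁻¹) := by
      ext i j
      simp [hI, dslope_of_ne _ hza, slope_def_field, div_eq_inv_mul]
    have hSz : S z = T z * ((1 - Q) + (z - a)⁻¹ • Q) := by
      simp only [hSdef, hDz, mul_add, Matrix.smul_mul, Matrix.mul_smul, sub_mul, hAQ, sub_zero]
    have hu : IsUnit (S z).det := isUnit_iff_ne_zero.2 hz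
    have hone : T z * (((1 - Q) + (z - a)⁻¹ • Q) * (S z)⁻¹) = 1 := by
      rw [← mul_assoc, ← hSz, Matrix.mul_nonsing_inv _ hu]
    refine ⟨?_, ?_⟩
    · intro h0
      have := congrArg Matrix.det hone
      rw [Matrix.det_mul, h0, zero_mul, Matrix.det_one] at this
      exact zero_ne_one this
    · rw [Matrix.inv_eq_right_inv hone, hIz]
      simp only [add_mul, Matrix.smul_mul, Matrix.mul_smul, mul_sub, smul_sub]
      abel
  · intro w
    have hu : IsUnit (S a).det := isUnit_iff_ne_zero.2 hSa
    refine ⟨?_, (S a)⁻¹ *ᵥ w, ?_⟩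
    · rw [Matrix.mulVec_mulVec, ← mul_assoc, hAQ, zero_mul, Matrix.zero_mulVec]
    · have : S a *ᵥ ((S a)⁻¹ *ᵥ w) = w := by
        rw [Matrix.mulVec_mulVec, Matrix.mul_nonsing_inv _ hu, Matrix.one_mulVec]
      have hS : S a = T a + T' * Q := by
        simp only [hSdef, hDa, mul_sub, mul_one, hAQ, sub_zero]
      have h2 : T a *ᵥ ((S a)⁻¹ *ᵥ w) + T' *ᵥ (Q *ᵥ ((S a)⁻¹ *ᵥ w)) = w := by
        rw [Matrix.mulVec_mulVec _ T', ← Matrix.add_mulVec, ← hS, this]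
      rw [← Matrix.mulVec_mulVec _ Q, h2]

end SimplePole

section ODE

theorem hasDerivAt_ccos (ω : ℂ) (s : ℝ) :
    HasDerivAt (fun s : ℝ => Complex.cos (ω * s)) (-ω * Complex.sin (ω * s)) s := by
  have h := ((Complex.hasDerivAt_cos (ω * s)).comp (s : ℂ)
    ((hasDerivAt_id (s : ℂ)).const_mul ω)).comp_ofReal
  simpa [Function.comp_def, mul_comm] using h

theorem hasDerivAt_csin (ω : ℂ) (s : ℝ) :
    HasDerivAt (fun s : ℝ => Complex.sin (ω * s)) (ω * Complex.cos (ω * s)) s := by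
  have h := ((Complex.hasDerivAt_sin (ω * s)).comp (s : ℂ)
    ((hasDerivAt_id (s : ℂ)).const_mul ω)).comp_ofReal
  simpa [Function.comp_def, mul_comm] using h

theorem contDiff_ccos (ω : ℂ) {n : WithTop ℕ∞} :
    ContDiff ℝ n (fun s : ℝ => Complex.cos (ω * s)) :=
  (Complex.contDiff_cos.restrict_scalars ℝ).comp
    (contDiff_const.mul Complex.ofRealCLM.contDiff)

theorem contDiff_csin (ω : ℂ) {n : WithTop ℕ∞} :
    ContDiff ℝ n (fun s : ℝ => Complex.sin (ω * s)) :=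
  (Complex.contDiff_sin.restrict_scalars ℝ).comp
    (contDiff_const.mul Complex.ofRealCLM.contDiff)

theorem eq_cos_add_sin_of_ode {ω : ℂ} (hω : ω ≠ 0) {f : ℝ → ℂ} (hf : ContDiff ℝ 2 f)
    (hode : ∀ x, deriv (deriv f) x = -ω ^ 2 * f x) (s : ℝ) :
    f s = f 0 * Complex.cos (ω * s) + deriv f 0 / ω * Complex.sin (ω * s) := by
  have h1 : ∀ x, HasDerivAt f (deriv f x) x := fun x =>
    ((hf.differentiable (by norm_num)) x).hasDerivAt
  have h2 : ∀ x, HasDerivAt (deriv f) (-ω ^ 2 * f x) x := fun x => by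
    rw [← hode x]
    have : ContDiff ℝ 1 (deriv f) := by
      have h : ContDiff ℝ (1 + 1) f := by simpa [one_add_one_eq_two] using hf
      exact (contDiff_succ_iff_deriv.1 h).2.2
    exact ((this.differentiable (by norm_num)) x).hasDerivAt
  have hP : ∀ x, f x * Complex.cos (ω * x) - deriv f x / ω * Complex.sin (ω * x) = f 0 := by
    intro x
    have hd : ∀ y, HasDerivAt (fun x : ℝ => f x * Complex.cos (ω * x) -
        deriv f x / ω * Complex.sin (ω * x)) 0 y := by
      intro y
      refine (((h1 y).mul (hasDerivAt_ccos ω y)).sub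
        (((h2 y).div_const ω).mul (hasDerivAt_csin ω y))).congr_deriv ?_
      field_simp
      ring
    have := is_const_of_deriv_eq_zero (fun y => (hd y).differentiableAt)
      (fun y => (hd y).deriv) x 0
    simpa using this
  have hQ : ∀ x, f x * Complex.sin (ω * x) + deriv f x / ω * Complex.cos (ω * x) =
      deriv f 0 / ω := by
    intro x
    have hd : ∀ y, HasDerivAt (fun x : ℝ => f x * Complex.sin (ω * x) +
        deriv f x / ω * Complex.cos (ω * x)) 0 y := by
      intro y
      refine (((h1 y).mul (hasDerivAt_csin ω y)).add
        (((h2 y).div_const ω).mul (hasDerivAt_ccos ω y))).congr_deriv ?_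
      field_simp
      ring
    have := is_const_of_deriv_eq_zero (fun y => (hd y).differentiableAt)
      (fun y => (hd y).deriv) x 0
    simpa using this
  rw [← hP s, ← hQ s]
  linear_combination (-f s) * Complex.sin_sq_add_cos_sq (ω * s)

end ODE

namespace MetricGraph

open scoped Matrix

variable (G : MetricGraph)

/-- The edgewise function `x_{o e} cos (ω s) + x_e sin (ω s)` with coefficients `x`, indexed by
the edges and the vertices. -/
def trig (ω : ℂ) (x : G.E ⊕ G.V → ℂ) (e : G.E) (s : ℝ) : ℂ :=
  x (Sum.inr (G.o e)) * Complex.cos (ω * s) + x (Sum.inl e) * Complex.sin (ω * s)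

theorem trig_zero (ω : ℂ) (x : G.E ⊕ G.V → ℂ) (e : G.E) :
    G.trig ω x e 0 = x (Sum.inr (G.o e)) := by
  simp [trig]

/-- The derivative of `trig`. -/
def trigDer (ω : ℂ) (x : G.E ⊕ G.V → ℂ) (e : G.E) (s : ℝ) : ℂ :=
  ω * (x (Sum.inl e) * Complex.cos (ω * s) - x (Sum.inr (G.o e)) * Complex.sin (ω * s))

theorem hasDerivAt_trig (ω : ℂ) (x : G.E ⊕ G.V → ℂ) (e : G.E) (s : ℝ) :
    HasDerivAt (G.trig ω x e) (G.trigDer ω x e s) s := by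
  refine (((hasDerivAt_ccos ω s).const_mul (x (Sum.inr (G.o e)))).add
    ((hasDerivAt_csin ω s).const_mul (x (Sum.inl e)))).congr_deriv ?_
  rw [trigDer]
  ring

theorem deriv_trig (ω : ℂ) (x : G.E ⊕ G.V → ℂ) (e : G.E) :
    deriv (G.trig ω x e) = G.trigDer ω x e :=
  funext fun s => (G.hasDerivAt_trig ω x e s).deriv

theorem hasDerivAt_trigDer (ω : ℂ) (x : G.E ⊕ G.V → ℂ) (e : G.E) (s : ℝ) :
    HasDerivAt (G.trigDer ω x e) (-ω ^ 2 * G.trig ω x e s) s := by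
  refine ((((hasDerivAt_ccos ω s).const_mul (x (Sum.inl e))).sub
    ((hasDerivAt_csin ω s).const_mul (x (Sum.inr (G.o e))))).const_mul ω).congr_deriv ?_
  rw [trig]
  ring

theorem contDiff_trig (ω : ℂ) (x : G.E ⊕ G.V → ℂ) (e : G.E) {n : WithTop ℕ∞} :
    ContDiff ℝ n (G.trig ω x e) :=
  (contDiff_const.mul (contDiff_ccos ω)).add (contDiff_const.mul (contDiff_csin ω))

theorem trig_add (ω : ℂ) (x y : G.E ⊕ G.V → ℂ) (e : G.E) (s : ℝ) :
    G.trig ω (x + y) e s = G.trig ω x e s + G.trig ω y e s := by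
  simp only [trig, Pi.add_apply]
  ring

theorem trig_smul (ω c : ℂ) (x : G.E ⊕ G.V → ℂ) (e : G.E) (s : ℝ) :
    G.trig ω (c • x) e s = c * G.trig ω x e s := by
  simp only [trig, Pi.smul_apply, smul_eq_mul]
  ring

theorem trigDer_add (ω : ℂ) (x y : G.E ⊕ G.V → ℂ) (e : G.E) (s : ℝ) :
    G.trigDer ω (x + y) e s = G.trigDer ω x e s + G.trigDer ω y e s := by
  simp only [trigDer, Pi.add_apply]
  ring

theorem trigDer_smul (ω c : ℂ) (x : G.E ⊕ G.V → ℂ) (e : G.E) (s : ℝ) :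
    G.trigDer ω (c • x) e s = c * G.trigDer ω x e s := by
  simp only [trigDer, Pi.smul_apply, smul_eq_mul]
  ring

theorem normDer_trig (ω : ℂ) (x : G.E ⊕ G.V → ℂ) (v : G.V) :
    G.normDer (G.trig ω x) v =
      (∑ e ∈ Finset.univ.filter fun e => G.t e = v, G.trigDer ω x e (G.L e)) -
        ∑ e ∈ Finset.univ.filter fun e => G.o e = v, G.trigDer ω x e 0 := by
  simp only [normDer, deriv_trig]

/-- The linear system for the coefficients of an edgewise solution of `-f'' = ω² f`: its
components are the jumps at the terminal vertices of the edges and the normal derivatives. -/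
def vertexMap (ω : ℂ) : (G.E ⊕ G.V → ℂ) →ₗ[ℂ] (G.E ⊕ G.V → ℂ) where
  toFun x := Sum.elim (fun e => G.trig ω x e (G.L e) - x (Sum.inr (G.t e)))
    (fun v => G.normDer (G.trig ω x) v)
  map_add' x y := by
    ext (e | v)
    · simp only [Sum.elim_inl, Pi.add_apply, trig_add]
      ring
    · simp only [Sum.elim_inr, Pi.add_apply, normDer_trig, trigDer_add, Finset.sum_add_distrib]
      ring
  map_smul' c x := by
    ext (e | v)
    · simp only [Sum.elim_inl, Pi.smul_apply, trig_smul, smul_eq_mul, RingHom.id_apply]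
      ring
    · simp only [Sum.elim_inr, Pi.smul_apply, normDer_trig, trigDer_smul, smul_eq_mul,
        RingHom.id_apply, ← Finset.mul_sum]
      ring

theorem vertexMap_inl (ω : ℂ) (x : G.E ⊕ G.V → ℂ) (e : G.E) :
    G.vertexMap ω x (Sum.inl e) = G.trig ω x e (G.L e) - x (Sum.inr (G.t e)) := rfl

theorem vertexMap_inr (ω : ℂ) (x : G.E ⊕ G.V → ℂ) (v : G.V) :
    G.vertexMap ω x (Sum.inr v) = G.normDer (G.trig ω x) v := rfl

/-- The matrix of `vertexMap`. -/
def vertexMat (ω : ℂ) : Matrix (G.E ⊕ G.V) (G.E ⊕ G.V) ℂ := LinearMap.toMatrix' (G.vertexMap ω)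

theorem vertexMat_mulVec (ω : ℂ) (x : G.E ⊕ G.V → ℂ) :
    G.vertexMat ω *ᵥ x = G.vertexMap ω x :=
  LinearMap.toMatrix'_mulVec _ _

theorem analyticAt_vertexMap (x : G.E ⊕ G.V → ℂ) (i : G.E ⊕ G.V) (ω : ℂ) :
    AnalyticAt ℂ (fun ω => G.vertexMap ω x i) ω := by
  apply Differentiable.analyticAt
  rcases i with e | v
  · simp only [vertexMap_inl, trig]
    fun_prop
  · simp only [vertexMap_inr, normDer_trig, trigDer]
    fun_prop

theorem analyticAt_vertexMat (i j : G.E ⊕ G.V) (ω : ℂ) :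
    AnalyticAt ℂ (fun ω => G.vertexMat ω i j) ω := by
  simp only [vertexMat, LinearMap.toMatrix'_apply]
  exact G.analyticAt_vertexMap _ _ _

variable {G}

theorem ContVert.vtxVal_o {f : G.E → ℝ → ℂ} (hf : G.ContVert f) (e : G.E) :
    G.vtxVal f (G.o e) = f e 0 := by
  have h : ∃ e', G.o e' = G.o e := ⟨e, rfl⟩
  rw [vtxVal, dif_pos h]
  exact hf.1 _ _ h.choose_spec

theorem ContVert.vtxVal_t {f : G.E → ℝ → ℂ} (hf : G.ContVert f) (e : G.E) :
    G.vtxVal f (G.t e) = f e (G.L e) := by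
  rw [vtxVal]
  split_ifs with h
  · exact hf.2.1 _ _ h.choose_spec
  · have hs := (G.noIsolated (G.t e)).choose_spec
    rcases hs with hs | hs
    · exact absurd ⟨_, hs⟩ h
    · exact hf.2.2 _ _ hs

theorem contVert_of_values {f : G.E → ℝ → ℂ} {u : G.V → ℂ} (ho : ∀ e, f e 0 = u (G.o e))
    (ht : ∀ e, f e (G.L e) = u (G.t e)) : G.ContVert f :=
  ⟨fun e₁ e₂ h => by rw [ho, ho, h], fun e₁ e₂ h => by rw [ho, ht, h],
    fun e₁ e₂ h => by rw [ht, ht, h]⟩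

theorem vtxVal_of_values {f : G.E → ℝ → ℂ} {u : G.V → ℂ} (ho : ∀ e, f e 0 = u (G.o e))
    (ht : ∀ e, f e (G.L e) = u (G.t e)) (v : G.V) : G.vtxVal f v = u v := by
  have hc := contVert_of_values ho ht
  obtain ⟨e, rfl | rfl⟩ := G.noIsolated v
  · rw [hc.vtxVal_o, ho]
  · rw [hc.vtxVal_t, ht]

theorem isSol_trig {ω : ℂ} {x : G.E ⊕ G.V → ℂ}
    (hx : ∀ e, G.vertexMap ω x (Sum.inl e) = 0) : G.IsSol (ω ^ 2) (G.trig ω x) := by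
  refine ⟨fun e => G.contDiff_trig ω x e, fun e s => ?_, ?_⟩
  · rw [deriv_trig]
    exact (G.hasDerivAt_trigDer ω x e s).deriv
  · exact contVert_of_values (u := fun v => x (Sum.inr v)) (fun e => G.trig_zero ω x e)
      (fun e => sub_eq_zero.1 (hx e))

theorem vtxVal_trig {ω : ℂ} {x : G.E ⊕ G.V → ℂ}
    (hx : ∀ e, G.vertexMap ω x (Sum.inl e) = 0) (v : G.V) :
    G.vtxVal (G.trig ω x) v = x (Sum.inr v) :=
  vtxVal_of_values (u := fun v => x (Sum.inr v)) (fun e => G.trig_zero ω x e)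
    (fun e => sub_eq_zero.1 (hx e)) v

theorem IsSol.exists_trig {ω : ℂ} (hω : ω ≠ 0) {f : G.E → ℝ → ℂ} (hf : G.IsSol (ω ^ 2) f) :
    ∃ x, f = G.trig ω x ∧ ∀ e, G.vertexMap ω x (Sum.inl e) = 0 := by
  have hfx : f = G.trig ω (Sum.elim (fun e => deriv (f e) 0 / ω) (G.vtxVal f)) := by
    funext e s
    rw [eq_cos_add_sin_of_ode hω (hf.1 e) (hf.2.1 e) s, trig, Sum.elim_inr, Sum.elim_inl,
      hf.2.2.vtxVal_o]
  refine ⟨_, hfx, fun e => ?_⟩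
  rw [vertexMap_inl, ← hfx, Sum.elim_inr, hf.2.2.vtxVal_t, sub_self]

theorem TW_apply_of_det_ne_zero (B : Finset G.V) {ω : ℂ} (hω : ω ≠ 0)
    (hdet : (G.vertexMat ω).det ≠ 0) (k l : B) :
    G.TW B (ω ^ 2) k l = (G.vertexMat ω)⁻¹ (Sum.inr k) (Sum.inr l) := by
  have hu : IsUnit (G.vertexMat ω).det := isUnit_iff_ne_zero.2 hdet
  have key : ∀ x, (∀ e, G.vertexMap ω x (Sum.inl e) = 0) →
      (G.IsTWsol (ω ^ 2) l (G.trig ω x) ↔ G.vertexMap ω x = Pi.single (Sum.inr (l : G.V)) 1) := by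
    intro x hx
    constructor
    · rintro ⟨-, h1, h2⟩
      ext (e | v)
      · rw [hx e]
        simp
      · rw [vertexMap_inr]
        by_cases hv : v = l
        · rw [hv, h1]
          simp
        · rw [h2 v hv]
          simp [hv]
    · intro h
      refine ⟨isSol_trig hx, ?_, fun v hv => ?_⟩
      · rw [← vertexMap_inr, h]
        simp
      · rw [← vertexMap_inr, h]
        simp [hv]
  have hex : ∃ f, G.IsTWsol (ω ^ 2) l f := by
    set x := (G.vertexMat ω)⁻¹ *ᵥ Pi.single (Sum.inr (l : G.V)) 1 with hxdef
    have hx : G.vertexMap ω x = Pi.single (Sum.inr (l : G.V)) 1 := by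
      rw [← vertexMat_mulVec, hxdef, Matrix.mulVec_mulVec, Matrix.mul_nonsing_inv _ hu,
        Matrix.one_mulVec]
    refine ⟨G.trig ω x, (key x fun e => ?_).2 hx⟩
    rw [hx]
    simp
  have hch := hex.choose_spec
  obtain ⟨x, hfx, hx⟩ := hch.1.exists_trig hω
  have hT : (G.TW B (ω ^ 2)) k l = G.vtxVal hex.choose k := by
    rw [TW, Matrix.of_apply, dif_pos hex]
  rw [hT, hfx, vtxVal_trig hx]
  rw [hfx, key x hx] at hch
  have : x = (G.vertexMat ω)⁻¹ *ᵥ Pi.single (Sum.inr (l : G.V)) 1 := by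
    rw [← hch, ← vertexMat_mulVec, Matrix.mulVec_mulVec, Matrix.nonsing_inv_mul _ hu,
      Matrix.one_mulVec]
  rw [this]
  simp

end MetricGraph

namespace MetricGraph

open scoped Matrix

variable (G : MetricGraph)

/-- The bilinear pairing `∑ₑ ∫₀^{L e} f_e g_e` of two trigonometric functions. -/
def pairing (ω₀ ω : ℂ) (x y : G.E ⊕ G.V → ℂ) : ℂ :=
  ∑ e, ∫ s in (0 : ℝ)..G.L e, G.trig ω x e s * G.trig ω₀ y e s

/-- The boundary form of Green's identity. -/
def boundaryForm (ω₀ : ℂ) (y w : G.E ⊕ G.V → ℂ) : ℂ :=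
  ∑ v, w (Sum.inr v) * y (Sum.inr v) - ∑ e, w (Sum.inl e) * G.trigDer ω₀ y e (G.L e)

theorem continuous_trig (x : G.E ⊕ G.V → ℂ) (e : G.E) :
    Continuous fun p : ℂ × ℝ => G.trig p.1 x e p.2 := by
  unfold trig
  fun_prop

theorem continuous_trig_right (ω : ℂ) (x : G.E ⊕ G.V → ℂ) (e : G.E) :
    Continuous (G.trig ω x e) := by
  unfold trig
  fun_prop

theorem continuous_pairing (ω₀ : ℂ) (x y : G.E ⊕ G.V → ℂ) :
    Continuous fun ω => G.pairing ω₀ ω x y := by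
  refine continuous_finsetSum _ fun e _ => ?_
  refine intervalIntegral.continuous_parametric_intervalIntegral_of_continuous' ?_ _ _
  exact (G.continuous_trig x e).mul ((G.continuous_trig_right ω₀ y e).comp continuous_snd)

theorem pairing_comm (ω : ℂ) (x y : G.E ⊕ G.V → ℂ) :
    G.pairing ω ω x y = G.pairing ω ω y x := by
  simp only [pairing, mul_comm]

theorem sum_normDer_mul (ω : ℂ) (x : G.E ⊕ G.V → ℂ) (y : G.V → ℂ) :
    ∑ v, G.normDer (G.trig ω x) v * y v =
      ∑ e, (G.trigDer ω x e (G.L e) * y (G.t e) - G.trigDer ω x e 0 * y (G.o e)) := by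
  simp only [normDer_trig, sub_mul, Finset.sum_sub_distrib, Finset.sum_mul]
  congr 1
  · rw [← Finset.sum_fiberwise Finset.univ G.t fun e => G.trigDer ω x e (G.L e) * y (G.t e)]
    refine Finset.sum_congr rfl fun v _ => Finset.sum_congr rfl fun e he => ?_
    rw [(Finset.mem_filter.1 he).2]
  · rw [← Finset.sum_fiberwise Finset.univ G.o fun e => G.trigDer ω x e 0 * y (G.o e)]
    refine Finset.sum_congr rfl fun v _ => Finset.sum_congr rfl fun e he => ?_
    rw [(Finset.mem_filter.1 he).2]

theorem edge_green (ω₀ ω : ℂ) (x y : G.E ⊕ G.V → ℂ) (e : G.E) (l : ℝ) :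
    (ω₀ ^ 2 - ω ^ 2) * ∫ s in (0 : ℝ)..l, G.trig ω x e s * G.trig ω₀ y e s =
      (G.trigDer ω x e l * G.trig ω₀ y e l - G.trig ω x e l * G.trigDer ω₀ y e l) -
      (G.trigDer ω x e 0 * G.trig ω₀ y e 0 - G.trig ω x e 0 * G.trigDer ω₀ y e 0) := by
  rw [← intervalIntegral.integral_const_mul]
  refine intervalIntegral.integral_eq_sub_of_hasDerivAt
    (f := fun s => G.trigDer ω x e s * G.trig ω₀ y e s - G.trig ω x e s * G.trigDer ω₀ y e s)
    (fun s _ => ?_) ?_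
  · refine (((G.hasDerivAt_trigDer ω x e s).mul (G.hasDerivAt_trig ω₀ y e s)).sub
      ((G.hasDerivAt_trig ω x e s).mul (G.hasDerivAt_trigDer ω₀ y e s))).congr_deriv ?_
    ring
  · exact (continuous_const.mul ((G.continuous_trig_right ω x e).mul
      (G.continuous_trig_right ω₀ y e))).intervalIntegrable _ _

theorem green {ω₀ : ℂ} (ω : ℂ) (x : G.E ⊕ G.V → ℂ) {y : G.E ⊕ G.V → ℂ}
    (hy : G.vertexMap ω₀ y = 0) :
    (ω₀ ^ 2 - ω ^ 2) * G.pairing ω₀ ω x y = G.boundaryForm ω₀ y (G.vertexMap ω x) := by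
  have hn : ∑ v, G.normDer (G.trig ω₀ y) v * x (Sum.inr v) = 0 :=
    Finset.sum_eq_zero fun v _ => by rw [← vertexMap_inr, hy, Pi.zero_apply, zero_mul]
  have ht : ∀ e, G.trig ω₀ y e (G.L e) = y (Sum.inr (G.t e)) := fun e => by
    have := congrFun hy (Sum.inl e)
    exact sub_eq_zero.1 this
  have h1 := G.sum_normDer_mul ω x fun v => y (Sum.inr v)
  have h2 := G.sum_normDer_mul ω₀ y fun v => x (Sum.inr v)
  rw [boundaryForm]
  simp only [vertexMap_inr, vertexMap_inl]
  rw [h1, ← sub_zero (∑ e, _), ← hn, h2, pairing, Finset.mul_sum, ← Finset.sum_sub_distrib,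
    ← Finset.sum_sub_distrib]
  refine Finset.sum_congr rfl fun e _ => ?_
  rw [edge_green, ht, trig_zero, trig_zero]
  ring

theorem boundaryForm_vertexMap_self {ω₀ : ℂ} (x : G.E ⊕ G.V → ℂ) {y : G.E ⊕ G.V → ℂ}
    (hy : G.vertexMap ω₀ y = 0) : G.boundaryForm ω₀ y (G.vertexMap ω₀ x) = 0 := by
  rw [← G.green ω₀ x hy, sub_self, zero_mul]

theorem boundaryForm_add (ω₀ : ℂ) (y w w' : G.E ⊕ G.V → ℂ) :
    G.boundaryForm ω₀ y (w + w') = G.boundaryForm ω₀ y w + G.boundaryForm ω₀ y w' := by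
  simp only [boundaryForm, Pi.add_apply, add_mul, Finset.sum_add_distrib]
  ring

theorem boundaryForm_deriv {Ω : ℂ → ℂ} {a : ℂ} (hΩ : ∀ z, Ω z ^ 2 = z) (hc : ContinuousAt Ω a)
    {T' : Matrix (G.E ⊕ G.V) (G.E ⊕ G.V) ℂ}
    (hT' : ∀ i j, HasDerivAt (fun z => G.vertexMat (Ω z) i j) (T' i j) a)
    (x : G.E ⊕ G.V → ℂ) {y : G.E ⊕ G.V → ℂ} (hy : G.vertexMap (Ω a) y = 0) :
    G.boundaryForm (Ω a) y (T' *ᵥ x) = -G.pairing (Ω a) (Ω a) x y := by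
  have hd : ∀ i, HasDerivAt (fun z => G.vertexMap (Ω z) x i) ((T' *ᵥ x) i) a := by
    intro i
    simp only [← vertexMat_mulVec, Matrix.mulVec, dotProduct]
    exact HasDerivAt.fun_sum fun j _ => (hT' i j).mul_const _
  have h1 : HasDerivAt (fun z => G.boundaryForm (Ω a) y (G.vertexMap (Ω z) x))
      (G.boundaryForm (Ω a) y (T' *ᵥ x)) a := by
    unfold boundaryForm
    exact (HasDerivAt.fun_sum fun v _ => (hd _).mul_const _).sub
      (HasDerivAt.fun_sum fun e _ => (hd _).mul_const _)
  have h2 : HasDerivAt (fun z => G.boundaryForm (Ω a) y (G.vertexMap (Ω z) x))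
      (-G.pairing (Ω a) (Ω a) x y) a := by
    rw [hasDerivAt_iff_tendsto_slope]
    have hcont : ContinuousAt (fun z => -G.pairing (Ω a) (Ω z) x y) a :=
      ((G.continuous_pairing (Ω a) x y).continuousAt.comp hc).neg
    refine (hcont.tendsto.mono_left nhdsWithin_le_nhds).congr' ?_
    filter_upwards [self_mem_nhdsWithin] with z hz
    have hz' : z - a ≠ 0 := sub_ne_zero.2 hz
    rw [slope_def_field, ← G.green (Ω z) x hy, ← G.green (Ω a) x hy, hΩ, hΩ, sub_self, zero_mul,
      sub_zero, eq_div_iff hz']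
    ring
  exact h1.unique h2

variable {G}

theorem star_trig (ω : ℝ) (x : G.E ⊕ G.V → ℂ) (e : G.E) (s : ℝ) :
    G.trig ω (star x) e s = star (G.trig ω x e s) := by
  simp only [trig, Pi.star_apply, star_add, star_mul', RCLike.star_def, ← Complex.cos_conj,
    ← Complex.sin_conj, map_mul, Complex.conj_ofReal]

theorem star_trigDer (ω : ℝ) (x : G.E ⊕ G.V → ℂ) (e : G.E) (s : ℝ) :
    G.trigDer ω (star x) e s = star (G.trigDer ω x e s) := by
  simp only [trigDer, Pi.star_apply, star_sub, star_mul', RCLike.star_def, ← Complex.cos_conj,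
    ← Complex.sin_conj, map_mul, Complex.conj_ofReal]

theorem vertexMap_star {ω : ℝ} {x : G.E ⊕ G.V → ℂ} (hx : G.vertexMap ω x = 0) :
    G.vertexMap ω (star x) = 0 := by
  have h : G.vertexMap ω (star x) = star (G.vertexMap ω x) := by
    ext (e | v)
    · simp only [vertexMap_inl, Pi.star_apply, star_trig, star_sub]
    · simp only [vertexMap_inr, Pi.star_apply, normDer_trig, star_trigDer, star_sub, star_sum]
  rw [h, hx, star_zero]

theorem eq_zero_of_pairing_star {ω : ℝ} (hω : 0 < ω) {x : G.E ⊕ G.V → ℂ}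
    (hx : ∀ e, G.vertexMap ω x (Sum.inl e) = 0) (h : G.pairing ω ω x (star x) = 0) : x = 0 := by
  have hselfpair : ∀ e, ∫ s in (0 : ℝ)..G.L e, G.trig ω x e s * G.trig ω (star x) e s =
      ((∫ s in (0 : ℝ)..G.L e, ‖G.trig ω x e s‖ ^ 2 : ℝ) : ℂ) := by
    intro e
    rw [← intervalIntegral.integral_ofReal]
    refine intervalIntegral.integral_congr fun s _ => ?_
    simp only [star_trig, RCLike.star_def, Complex.mul_conj, Complex.normSq_eq_norm_sq]
  have hsum : ∑ e, ∫ s in (0 : ℝ)..G.L e, ‖G.trig ω x e s‖ ^ 2 = 0 := by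
    have : ((∑ e, ∫ s in (0 : ℝ)..G.L e, ‖G.trig ω x e s‖ ^ 2 : ℝ) : ℂ) = 0 := by
      rw [Complex.ofReal_sum, ← h, pairing]
      exact Finset.sum_congr rfl fun e _ => (hselfpair e).symm
    exact_mod_cast this
  have hnn : ∀ e, 0 ≤ ∫ s in (0 : ℝ)..G.L e, ‖G.trig ω x e s‖ ^ 2 := fun e =>
    intervalIntegral.integral_nonneg (G.L_pos e).le fun s _ => by positivity
  have hz : ∀ e, ∀ s ∈ Set.Icc 0 (G.L e), G.trig ω x e s = 0 := by
    intro e s hs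
    by_contra hne
    have hpos : 0 < ∫ s in (0 : ℝ)..G.L e, ‖G.trig ω x e s‖ ^ 2 :=
      intervalIntegral.integral_pos (G.L_pos e)
        ((G.continuous_trig_right ω x e).norm.pow 2).continuousOn
        (fun s _ => by positivity) ⟨s, hs, by positivity⟩
    exact hpos.ne' ((Finset.sum_eq_zero_iff_of_nonneg fun e _ => hnn e).1 hsum e
      (Finset.mem_univ e))
  have ho : ∀ e, x (Sum.inr (G.o e)) = 0 := fun e => by
    rw [← G.trig_zero ω x e]
    exact hz e 0 ⟨le_rfl, (G.L_pos e).le⟩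
  have ht : ∀ e, x (Sum.inr (G.t e)) = 0 := fun e => by
    have := hx e
    rw [vertexMap_inl, hz e _ ⟨(G.L_pos e).le, le_rfl⟩, zero_sub, neg_eq_zero] at this
    exact this
  ext (e | v)
  · set s := min (G.L e) (1 / ω)
    have hs0 : 0 < s := lt_min (G.L_pos e) (by positivity)
    have h1 := hz e s ⟨hs0.le, min_le_left _ _⟩
    rw [trig, ho, zero_mul, zero_add, mul_eq_zero] at h1
    refine h1.resolve_right ?_
    have hs1 : ω * s ≤ 1 := by
      calc ω * s ≤ ω * (1 / ω) := mul_le_mul_of_nonneg_left (min_le_right _ _) hω.le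
        _ = 1 := by field_simp
    have : 0 < Real.sin (ω * s) := Real.sin_pos_of_pos_of_lt_pi (mul_pos hω hs0)
      (by linarith [Real.pi_gt_three])
    exact_mod_cast this.ne'
  · obtain ⟨e, rfl | rfl⟩ := G.noIsolated v
    · exact ho e
    · exact ht e

end MetricGraph

section Residue

variable {m : Type} {M H : ℂ → Matrix m m ℂ} {A : Matrix m m ℂ} {a : ℂ}

theorem matResidue_eq (hH : ∀ i j, AnalyticAt ℂ (fun z => H z i j) a)
    (hM : ∀ᶠ z in 𝓝[≠] a, M z = (z - a)⁻¹ • A + H z) : matResidue M a = A := by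
  ext k l
  have hball : ∀ᶠ R in 𝓝[>] (0 : ℝ), ∀ z ∈ Metric.closedBall a R,
      DifferentiableAt ℂ (fun z => H z k l) z ∧ (z ≠ a → M z = (z - a)⁻¹ • A + H z) := by
    have h : ∀ᶠ z in 𝓝 a, AnalyticAt ℂ (fun z => H z k l) z ∧
        (z ≠ a → M z = (z - a)⁻¹ • A + H z) :=
      (hH k l).eventually_analyticAt.and (eventually_nhdsWithin_iff.1 hM)
    obtain ⟨ε, hε, hε'⟩ := Metric.eventually_nhds_iff_ball.1 h
    filter_upwards [Ioo_mem_nhdsGT hε] with R hR z hz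
    have := hε' z (Metric.closedBall_subset_ball hR.2 hz)
    exact ⟨this.1.differentiableAt, this.2⟩
  have hres : ∀ᶠ R in 𝓝[>] (0 : ℝ),
      (2 * (π : ℂ) * Complex.I)⁻¹ * circleIntegral (fun z => M z k l) a R = A k l := by
    filter_upwards [hball, self_mem_nhdsWithin] with R hR hR0
    have hR0' : 0 < R := hR0
    have h1 : circleIntegral (fun z => M z k l) a R =
        circleIntegral (fun z => (z - a)⁻¹ * A k l + H z k l) a R := by
      refine circleIntegral.integral_congr hR0'.le fun z hz => ?_
      have hza : z ≠ a := by
        rintro rfl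
        simp [hR0'.ne] at hz
      simp only [(hR z (Metric.sphere_subset_closedBall hz)).2 hza, Matrix.add_apply,
        Matrix.smul_apply, smul_eq_mul]
    have hHc : ContinuousOn (fun z => H z k l) (Metric.closedBall a R) := fun z hz =>
      (hR z hz).1.continuousAt.continuousWithinAt
    have h2 : circleIntegral (fun z => H z k l) a R = 0 :=
      Complex.circleIntegral_eq_zero_of_differentiable_on_off_countable hR0'.le
        Set.countable_empty hHc fun z hz => (hR z (Metric.ball_subset_closedBall hz.1)).1
    have hi1 : CircleIntegrable (fun z => (z - a)⁻¹ * A k l) a R := by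
      refine ContinuousOn.circleIntegrable hR0'.le ?_
      refine ContinuousOn.mul (ContinuousOn.inv₀ (by fun_prop) fun z hz => ?_) continuousOn_const
      rw [sub_ne_zero]
      rintro rfl
      simp [hR0'.ne] at hz
    have hi2 : CircleIntegrable (fun z => H z k l) a R :=
      (hHc.mono Metric.sphere_subset_closedBall).circleIntegrable hR0'.le
    have h3 : circleIntegral (fun z => (z - a)⁻¹ * A k l) a R = 2 * π * Complex.I * A k l := by
      rw [show (fun z => (z - a)⁻¹ * A k l) = fun z => (A k l) • (z - a)⁻¹ by
        funext z; rw [smul_eq_mul, mul_comm], circleIntegral.integral_smul,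
        circleIntegral.integral_sub_center_inv a hR0'.ne', smul_eq_mul, mul_comm]
    rw [h1, circleIntegral.integral_add hi1 hi2, h2, h3, add_zero,
      inv_mul_cancel_left₀ Complex.two_pi_I_ne_zero]
  have hex : ∃ c : ℂ, ∀ᶠ R in 𝓝[>] (0 : ℝ),
      (2 * (π : ℂ) * Complex.I)⁻¹ * circleIntegral (fun z => M z k l) a R = c := ⟨_, hres⟩
  rw [matResidue, Matrix.of_apply, dif_pos hex]
  obtain ⟨R, h1, h2⟩ := (hres.and hex.choose_spec).exists
  rw [← h1, ← h2]

theorem matrix_rank_eq_zero_iff [Fintype m] : A.rank = 0 ↔ A = 0 := by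
  classical
  rw [Matrix.rank, Submodule.finrank_eq_zero, LinearMap.range_eq_bot, ← Matrix.toLin'_apply',
    LinearEquiv.map_eq_zero_iff]

theorem isPole_iff [Fintype m] (hH : ∀ i j, AnalyticAt ℂ (fun z => H z i j) a)
    (hM : ∀ᶠ z in 𝓝[≠] a, M z = (z - a)⁻¹ • A + H z) : isPole M a ↔ A ≠ 0 := by
  have hHt : Tendsto H (𝓝[≠] a) (𝓝 (H a)) := by
    have : Tendsto H (𝓝 a) (𝓝 (H a)) :=
      tendsto_pi_nhds.2 fun i => tendsto_pi_nhds.2 fun j => (hH i j).continuousAt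
    exact this.mono_left nhdsWithin_le_nhds
  have hsub : ∀ k : ℕ, Tendsto (fun z : ℂ => (z - a) ^ k) (𝓝[≠] a) (𝓝 (0 ^ k)) := fun k => by
    have : ContinuousAt (fun z : ℂ => (z - a) ^ k) a := by fun_prop
    simpa using this.tendsto.mono_left nhdsWithin_le_nhds
  have hpow : ∀ k : ℕ, Tendsto (fun z => (z - a) ^ (k + 1) • M z) (𝓝[≠] a)
      (𝓝 ((0 : ℂ) ^ k • A)) := by
    intro k
    have h := ((hsub k).smul_const A).add ((hsub (k + 1)).smul hHt)
    rw [pow_succ (0 : ℂ), mul_zero, zero_smul, add_zero] at h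
    refine h.congr' ?_
    filter_upwards [hM, self_mem_nhdsWithin] with z hz hza
    have hza' : z - a ≠ 0 := sub_ne_zero.2 hza
    rw [hz, smul_add, smul_smul, pow_succ, mul_assoc, mul_inv_cancel₀ hza', mul_one]
  constructor
  · rintro ⟨-, n, hn, ⟨A', hA', hlim⟩, -⟩ rfl
    obtain ⟨k, rfl⟩ := Nat.exists_eq_succ_of_ne_zero (Nat.one_le_iff_ne_zero.1 hn)
    have h := hpow k
    rw [smul_zero] at h
    exact hA' (tendsto_nhds_unique hlim h)
  · intro hA
    refine ⟨?_, 1, le_rfl, ⟨A, hA, by simpa using hpow 0⟩, by simpa using hpow 1⟩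
    have hev : ∀ᶠ z in 𝓝[≠] a, ∀ k l, AnalyticAt ℂ (fun z => H z k l) z := by
      refine Filter.Eventually.filter_mono nhdsWithin_le_nhds ?_
      exact Filter.eventually_all.2 fun k => Filter.eventually_all.2 fun l =>
        (hH k l).eventually_analyticAt
    have hM' : ∀ᶠ z in 𝓝[≠] a, ∀ᶠ w in 𝓝 z, M w = (w - a)⁻¹ • A + H w := by
      rw [eventually_nhdsWithin_iff] at hM ⊢
      filter_upwards [hM.eventually_nhds] with z hz hza
      filter_upwards [hz, isOpen_ne.mem_nhds hza] with w hw hwa using hw hwa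
    filter_upwards [hev, hM', self_mem_nhdsWithin] with z hz hMz hza k l
    have hza' : z - a ≠ 0 := sub_ne_zero.2 hza
    have : AnalyticAt ℂ (fun w => (w - a)⁻¹ * A k l + H w k l) z :=
      (((analyticAt_id.sub analyticAt_const).inv hza').mul analyticAt_const).add (hz k l)
    refine this.congr ?_
    filter_upwards [hMz] with w hw
    simp [hw]

end Residue

namespace MetricGraph

open scoped Matrix

variable (G : MetricGraph)

/-- Restriction of a coefficient vector to the vertices in `B`. -/
def restrictTo (B : Finset G.V) : (G.E ⊕ G.V → ℂ) →ₗ[ℂ] (B → ℂ) :=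
  LinearMap.funLeft ℂ ℂ fun v : B => Sum.inr (v : G.V)

/-- Coefficients of eigenfunctions which vanish at the vertices in `B`. -/
def kerVanishing (ω : ℂ) (B : Finset G.V) : Submodule ℂ (G.E ⊕ G.V → ℂ) :=
  LinearMap.ker (G.vertexMap ω) ⊓ LinearMap.ker (G.restrictTo B)

variable {G}

theorem finrank_map_add_finrank_kerVanishing (ω : ℂ) (B : Finset G.V) :
    Module.finrank ℂ (Submodule.map (G.restrictTo B) (LinearMap.ker (G.vertexMap ω))) +
      Module.finrank ℂ (G.kerVanishing ω B) =
      Module.finrank ℂ (LinearMap.ker (G.vertexMap ω)) := by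
  set K := LinearMap.ker (G.vertexMap ω)
  have h := ((G.restrictTo B).domRestrict K).finrank_range_add_finrank_ker
  rw [LinearMap.range_domRestrict] at h
  rw [← h]
  congr 1
  have : Submodule.map K.subtype (LinearMap.ker ((G.restrictTo B).domRestrict K)) =
      G.kerVanishing ω B := by
    rw [LinearMap.ker_domRestrict, Submodule.map_comap_subtype]
    rfl
  rw [← this]
  exact (Submodule.equivMapOfInjective K.subtype K.injective_subtype _).finrank_eq.symm

/-- The residue is the Gram-type matrix of the traces of the eigenspace. -/
theorem range_residue {ω : ℝ} (hω : 0 < ω) (B : Finset G.V)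
    {R : Matrix (G.E ⊕ G.V) (G.E ⊕ G.V) ℂ}
    (hRK : ∀ w, G.vertexMap ω (R *ᵥ w) = 0)
    (hR : ∀ w y, G.vertexMap ω y = 0 → G.boundaryForm ω y w = -G.pairing ω ω (R *ᵥ w) y) :
    LinearMap.range (R.submatrix (fun v : B => Sum.inr (v : G.V))
      (fun v : B => Sum.inr (v : G.V))).mulVecLin =
      Submodule.map (G.restrictTo B) (LinearMap.ker (G.vertexMap ω)) := by
  set A := R.submatrix (fun v : B => (Sum.inr (v : G.V) : G.E ⊕ G.V))
      (fun v : B => Sum.inr (v : G.V)) with hA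
  have hinj : Function.Injective fun v : B => (Sum.inr (v : G.V) : G.E ⊕ G.V) :=
    Sum.inr_injective.comp Subtype.val_injective
  set ι : (B → ℂ) → (G.E ⊕ G.V → ℂ) := fun η =>
    ∑ v : B, η v • Pi.single (Sum.inr (v : G.V)) 1 with hι
  have hAη : ∀ η, A *ᵥ η = G.restrictTo B (R *ᵥ ι η) := by
    intro η
    ext k
    simp only [hι, Matrix.mulVec_sum, Matrix.mulVec_smul, restrictTo, LinearMap.funLeft_apply,
      Finset.sum_apply, Pi.smul_apply, Matrix.mulVec_single_one, Matrix.col_apply, smul_eq_mul]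
    simp only [Matrix.mulVec, dotProduct, hA, Matrix.submatrix_apply, mul_comm]
  have hform : ∀ η y, G.vertexMap ω y = 0 →
      η ⬝ᵥ G.restrictTo B y = -G.pairing ω ω (R *ᵥ ι η) y := by
    intro η y hy
    rw [← hR _ _ hy, boundaryForm]
    have h1 : ∀ e, ι η (Sum.inl e) = 0 := fun e => by
      simp [hι, Finset.sum_apply]
    have h2 : ∀ v, ι η (Sum.inr v) = ∑ w : B, if (w : G.V) = v then η w else 0 := fun v => by
      simp only [hι, Finset.sum_apply, Pi.smul_apply, Pi.single_apply, smul_eq_mul, mul_ite,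
        mul_one, mul_zero, Sum.inr.injEq, eq_comm]
    simp only [h1, h2, zero_mul, Finset.sum_const_zero, sub_zero, Finset.sum_mul, ite_mul]
    rw [Finset.sum_comm]
    simp only [Finset.sum_ite_eq, Finset.mem_univ, if_true]
    rfl
  refine le_antisymm ?_ ?_
  · rintro _ ⟨η, rfl⟩
    exact ⟨R *ᵥ ι η, hRK _, (hAη η).symm⟩
  · by_contra hle
    obtain ⟨p, hp, hpn⟩ := Set.not_subset.1 hle
    obtain ⟨f, hfp, hf⟩ := Submodule.exists_le_ker_of_notMem hpn
    set η : B → ℂ := fun v => f (Pi.single v 1) with hη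
    have hfη : ∀ x, f x = η ⬝ᵥ x := by
      intro x
      conv_lhs => rw [← Finset.univ_sum_single x]
      rw [map_sum]
      refine Finset.sum_congr rfl fun v _ => ?_
      rw [show Pi.single v (x v) = x v • (Pi.single v 1 : B → ℂ) by
        rw [← Pi.single_smul, smul_eq_mul, mul_one], map_smul, smul_eq_mul, mul_comm]
    have h0 : ∀ ξ, ξ ⬝ᵥ A *ᵥ η = 0 := by
      intro ξ
      have h1 : f (A *ᵥ ξ) = 0 := hf ⟨ξ, rfl⟩
      rw [hfη, hAη, hform _ _ (hRK _), pairing_comm, ← hform _ _ (hRK _), ← hAη] at h1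
      exact h1
    have hA0 : A *ᵥ η = 0 := dotProduct_eq_zero_iff.1 fun ξ => by
      rw [dotProduct_comm]
      exact h0 ξ
    have hstar : G.restrictTo B (star (R *ᵥ ι η)) = 0 := by
      have : G.restrictTo B (star (R *ᵥ ι η)) = star (G.restrictTo B (R *ᵥ ι η)) := rfl
      rw [this, ← hAη, hA0, star_zero]
    have hr : R *ᵥ ι η = 0 := by
      refine eq_zero_of_pairing_star hω (fun e => congrFun (hRK (ι η)) _) ?_
      rw [← neg_eq_zero, ← hform _ _ (vertexMap_star (hRK _)), hstar, dotProduct_zero]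
    obtain ⟨y, hy, rfl⟩ := hp
    apply hfp
    rw [hfη, hform _ _ hy, hr]
    simp [pairing, trig]

theorem exists_TW_residue (B : Finset G.V) {lam : ℝ} (hlam : 0 < lam) :
    ∃ (A : Matrix B B ℂ) (H : ℂ → Matrix B B ℂ),
      (∀ i j, AnalyticAt ℂ (fun z => H z i j) (lam : ℂ)) ∧
      (∀ᶠ z in 𝓝[≠] (lam : ℂ), G.TW B z = (z - lam)⁻¹ • A + H z) ∧
      A.rank + Module.finrank ℂ (G.kerVanishing (Real.sqrt lam : ℝ) B) =
        Module.finrank ℂ (LinearMap.ker (G.vertexMap (Real.sqrt lam : ℝ))) := by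
  set Ω : ℂ → ℂ := fun z => z ^ (((2 : ℕ) : ℂ)⁻¹) with hΩdef
  have hΩ : ∀ z, Ω z ^ 2 = z := fun z => Complex.cpow_nat_inv_pow z two_ne_zero
  have hω : 0 < Real.sqrt lam := Real.sqrt_pos.2 hlam
  have hΩa : Ω lam = (Real.sqrt lam : ℝ) := by
    rw [hΩdef, Real.sqrt_eq_rpow, Complex.ofReal_cpow hlam.le]
    norm_num
  have hΩan : AnalyticAt ℂ Ω lam :=
    analyticAt_id.cpow analyticAt_const (Or.inl (by simpa using hlam))
  have hTan : ∀ i j, AnalyticAt ℂ (fun z => G.vertexMat (Ω z) i j) (lam : ℂ) := fun i j =>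
    (G.analyticAt_vertexMat i j (Ω lam)).comp hΩan
  set T' : Matrix (G.E ⊕ G.V) (G.E ⊕ G.V) ℂ :=
    Matrix.of fun i j => deriv (fun z => G.vertexMat (Ω z) i j) (lam : ℂ)
  have hT' : ∀ i j, HasDerivAt (fun z => G.vertexMat (Ω z) i j) (T' i j) (lam : ℂ) := fun i j =>
    (hTan i j).differentiableAt.hasDerivAt
  have hbd := fun x y hy => G.boundaryForm_deriv hΩ hΩan.continuousAt hT' x (y := y) hy
  rw [hΩa] at hbd
  obtain ⟨R, H, hH, hinv, hR⟩ := exists_simplePole_inverse (T := fun z => G.vertexMat (Ω z))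
    hTan T' hT' (by
      intro x y hx hxy
      rw [vertexMat_mulVec, hΩa] at hx hxy
      have hs := vertexMap_star hx
      refine eq_zero_of_pairing_star hω (fun e => congrFun hx _) ?_
      rw [← neg_eq_zero, ← hbd _ _ hs, hxy]
      exact G.boundaryForm_vertexMap_self _ hs)
  simp only [vertexMat_mulVec, hΩa] at hR
  refine ⟨R.submatrix (fun v : B => Sum.inr (v : G.V)) (fun v : B => Sum.inr (v : G.V)),
    fun z => (H z).submatrix (fun v : B => Sum.inr (v : G.V)) (fun v : B => Sum.inr (v : G.V)),
    fun i j => hH _ _, ?_, ?_⟩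
  · have hne : ∀ᶠ z in 𝓝[≠] (lam : ℂ), Ω z ≠ 0 := by
      refine (hΩan.continuousAt.eventually_ne ?_).filter_mono nhdsWithin_le_nhds
      rw [hΩa]
      exact_mod_cast hω.ne'
    filter_upwards [hinv, hne] with z hz hz0
    ext k l
    conv_lhs => rw [← hΩ z]
    rw [TW_apply_of_det_ne_zero B hz0 hz.1, hz.2]
    rfl
  · rw [← finrank_map_add_finrank_kerVanishing, Matrix.rank, range_residue hω B
      (fun w => (hR w).1) fun w y hy => ?_]
    obtain ⟨-, u, hu⟩ := hR w
    conv_lhs => rw [hu]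
    rw [boundaryForm_add, boundaryForm_vertexMap_self _ _ hy, zero_add, hbd _ _ hy]

end MetricGraph

namespace MetricGraph

variable {G : MetricGraph}

theorem trig_coeff_eq_zero {ω : ℂ} (hω : ω ≠ 0) {x : G.E ⊕ G.V → ℂ} {e : G.E} {s : ℝ}
    (h0 : G.trig ω x e s = 0) (h1 : G.trigDer ω x e s = 0) :
    x (Sum.inr (G.o e)) = 0 ∧ x (Sum.inl e) = 0 := by
  have h1' := (mul_eq_zero.1 h1).resolve_left hω
  rw [trig] at h0
  have hcs := Complex.sin_sq_add_cos_sq (ω * s)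
  constructor
  · linear_combination Complex.cos (ω * s) * h0 - Complex.sin (ω * s) * h1' -
      x (Sum.inr (G.o e)) * hcs
  · linear_combination Complex.sin (ω * s) * h0 + Complex.cos (ω * s) * h1' -
      x (Sum.inl e) * hcs

/-- Eigenfunctions vanishing on the boundary are supported on the core. -/
theorem mem_coreEdges_of_ne_zero {B : Finset G.V} (hbd : ∀ v, G.IsBoundaryVertex v → v ∈ B)
    {ω : ℂ} (hω : ω ≠ 0) {x : G.E ⊕ G.V → ℂ} (hx : G.vertexMap ω x = 0)
    (hB : ∀ v ∈ B, x (Sum.inr v) = 0) {e : G.E}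
    (he : ¬(x (Sum.inr (G.o e)) = 0 ∧ x (Sum.inl e) = 0)) : e ∈ G.coreEdges := by
  set S : Set G.E := {e | ¬(x (Sum.inr (G.o e)) = 0 ∧ x (Sum.inl e) = 0)} with hS
  have htL : ∀ e, G.trig ω x e (G.L e) = x (Sum.inr (G.t e)) := fun e =>
    sub_eq_zero.1 (congrFun hx (Sum.inl e))
  have hout : ∀ e, e ∉ S → x (Sum.inr (G.o e)) = 0 ∧ x (Sum.inl e) = 0 := fun e he => by
    simpa [hS] using he
  have hoff : ∀ e, e ∉ S → x (Sum.inr (G.o e)) = 0 ∧ x (Sum.inr (G.t e)) = 0 := fun e he => by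
    obtain ⟨h1, h2⟩ := hout e he
    refine ⟨h1, ?_⟩
    rw [← htL, trig, h1, h2, zero_mul, zero_mul, add_zero]
  have hder : ∀ e, e ∉ S → ∀ s, G.trigDer ω x e s = 0 := fun e he s => by
    obtain ⟨h1, h2⟩ := hout e he
    rw [trigDer, h1, h2, zero_mul, zero_mul, sub_zero, mul_zero]
  refine ⟨S, fun v hv => ?_, he⟩
  have hv0 : x (Sum.inr v) = 0 := by
    by_cases hall : ∀ e, G.o e = v ∨ G.t e = v → e ∈ S
    · refine hB v (hbd v ?_)
      rw [IsBoundaryVertex, degree, ← hv, degreeIn]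
      congr 2
      · ext e
        exact ⟨fun h => ⟨hall e (Or.inl h), h⟩, fun h => h.2⟩
      · ext e
        exact ⟨fun h => ⟨hall e (Or.inr h), h⟩, fun h => h.2⟩
    · push Not at hall
      obtain ⟨e, rfl | rfl, he⟩ := hall
      · exact (hoff e he).1
      · exact (hoff e he).2
  have hn : G.normDer (G.trig ω x) v = 0 := congrFun hx (Sum.inr v)
  rw [normDer_trig] at hn
  have hcases : ({e | e ∈ S ∧ G.o e = v}.ncard = 1 ∧ {e | e ∈ S ∧ G.t e = v}.ncard = 0) ∨
      ({e | e ∈ S ∧ G.o e = v}.ncard = 0 ∧ {e | e ∈ S ∧ G.t e = v}.ncard = 1) := by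
    rw [degreeIn] at hv
    omega
  rcases hcases with ⟨h1, h0⟩ | ⟨h0, h1⟩
  · obtain ⟨e₀, he₀⟩ := Set.ncard_eq_one.1 h1
    have hmem : e₀ ∈ S ∧ G.o e₀ = v := by
      have : e₀ ∈ {e | e ∈ S ∧ G.o e = v} := he₀ ▸ rfl
      exact this
    rw [Set.ncard_eq_zero (Set.toFinite _)] at h0
    rw [Finset.sum_eq_zero, zero_sub, neg_eq_zero, Finset.sum_eq_single e₀] at hn
    · exact hmem.1 (trig_coeff_eq_zero hω (by rw [trig_zero, hmem.2, hv0]) hn)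
    · intro e he hne
      refine hder e (fun heS => hne ?_) _
      have : e ∈ {e | e ∈ S ∧ G.o e = v} := ⟨heS, (Finset.mem_filter.1 he).2⟩
      rwa [he₀] at this
    · intro h
      exact absurd (by simp [hmem.2]) h
    · intro e he
      refine hder e (fun heS => ?_) _
      have : e ∈ {e | e ∈ S ∧ G.t e = v} := ⟨heS, (Finset.mem_filter.1 he).2⟩
      rwa [h0] at this
  · obtain ⟨e₀, he₀⟩ := Set.ncard_eq_one.1 h1
    have hmem : e₀ ∈ S ∧ G.t e₀ = v := by
      have : e₀ ∈ {e | e ∈ S ∧ G.t e = v} := he₀ ▸ rfl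
      exact this
    rw [Set.ncard_eq_zero (Set.toFinite _)] at h0
    rw [sub_eq_zero, Finset.sum_eq_single e₀, Finset.sum_eq_zero] at hn
    · exact hmem.1 (trig_coeff_eq_zero hω (by rw [htL, hmem.2, hv0]) hn)
    · intro e he
      refine hder e (fun heS => ?_) _
      have : e ∈ {e | e ∈ S ∧ G.o e = v} := ⟨heS, (Finset.mem_filter.1 he).2⟩
      rwa [h0] at this
    · intro e he hne
      refine hder e (fun heS => hne ?_) _
      have : e ∈ {e | e ∈ S ∧ G.t e = v} := ⟨heS, (Finset.mem_filter.1 he).2⟩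
      rwa [he₀] at this
    · intro h
      exact absurd (by simp [hmem.2]) h

theorem kerVanishing_eq {B : Finset G.V} (hbd : ∀ v, G.IsBoundaryVertex v → v ∈ B)
    (hcore : ∀ v, G.IsProperCoreVertex v → v ∈ B) {ω : ℂ} (hω : ω ≠ 0) :
    G.kerVanishing ω B = G.kerVanishing ω Finset.univ := by
  ext x
  simp only [kerVanishing, Submodule.mem_inf, LinearMap.mem_ker]
  refine and_congr_right fun hx => ⟨fun h => ?_, fun h => ?_⟩
  · have hB : ∀ v ∈ B, x (Sum.inr v) = 0 := fun v hv => congrFun h ⟨v, hv⟩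
    ext ⟨v, -⟩
    change x (Sum.inr v) = 0
    by_cases hv : v ∈ B
    · exact hB v hv
    · have hnp : ¬G.IsProperCoreVertex v := fun h => hv (hcore v h)
      rw [IsProperCoreVertex] at hnp
      push Not at hnp
      obtain ⟨e, hev, he⟩ := hnp
      have h0 := not_not.1 (mt (mem_coreEdges_of_ne_zero hbd hω hx hB) he)
      rcases hev with rfl | rfl
      · exact h0.1
      · have := congrFun hx (Sum.inl e)
        rw [vertexMap_inl, trig, h0.1, h0.2, zero_mul, zero_mul, add_zero, zero_sub,
          Pi.zero_apply, neg_eq_zero] at this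
        exact this
  · ext ⟨v, hv⟩
    exact congrFun h ⟨v, Finset.mem_univ v⟩

end MetricGraph

namespace MetricGraph

variable {G : MetricGraph}

/-- `l` is a walk from `v` to `w` through edges of `S`. -/
def IsWalk (S : Set G.E) : G.V → G.V → List (G.E × Bool) → Prop
  | v, w, [] => v = w
  | v, w, a :: l => a.1 ∈ S ∧ G.esrc a.1 a.2 = v ∧ IsWalk S (G.edst a.1 a.2) w l

/-- The product of the edge signs along a list of directed edges. -/
def walkSign (σ : G.E → ℂ) (l : List (G.E × Bool)) : ℂ := (l.map fun a => σ a.1).prod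

variable {S : Set G.E} {σ : G.E → ℂ}

theorem walkSign_append (l l' : List (G.E × Bool)) :
    walkSign σ (l ++ l') = walkSign σ l * walkSign σ l' := by
  simp [walkSign]

theorem esrc_not (e : G.E) (d : Bool) : G.esrc e (!d) = G.edst e d := by
  cases d <;> rfl

theorem edst_not (e : G.E) (d : Bool) : G.edst e (!d) = G.esrc e d := by
  cases d <;> rfl

theorem isWalk_append {v w : G.V} {l l' : List (G.E × Bool)} :
    IsWalk S v w (l ++ l') ↔ ∃ u, IsWalk S v u l ∧ IsWalk S u w l' := by
  induction l generalizing v with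
  | nil => simp [IsWalk]
  | cons a l ih => simp only [List.cons_append, IsWalk, ih]; tauto

theorem IsWalk.exists_reverse {v w : G.V} {l : List (G.E × Bool)} (h : IsWalk S v w l) :
    ∃ l', IsWalk S w v l' ∧ walkSign σ l' = walkSign σ l := by
  induction l generalizing v with
  | nil => exact ⟨[], Eq.symm h, rfl⟩
  | cons a l ih =>
    obtain ⟨ha, hs, hl⟩ := h
    obtain ⟨l', hl', hsg⟩ := ih hl
    refine ⟨l' ++ [(a.1, !a.2)], isWalk_append.2 ⟨_, hl', ha, esrc_not _ _, ?_⟩, ?_⟩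
    · rw [edst_not]
      exact hs
    · rw [walkSign_append, hsg]
      simp [walkSign, mul_comm]

theorem IsWalk.mem {v w : G.V} {l : List (G.E × Bool)} (h : IsWalk S v w l) :
    ∀ a ∈ l, a.1 ∈ S := by
  induction l generalizing v with
  | nil => simp
  | cons a l ih =>
    obtain ⟨ha, -, hl⟩ := h
    simpa [ha] using fun e d h => ih hl (e, d) h

theorem IsWalk.walkSign_eq (hσ : ∀ e ∈ S, σ e = 1 ∨ σ e = -1) {v w : G.V}
    {l : List (G.E × Bool)} (h : IsWalk S v w l) : walkSign σ l = 1 ∨ walkSign σ l = -1 := by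
  induction l generalizing v with
  | nil => simp [walkSign]
  | cons a l ih =>
    obtain ⟨ha, -, hl⟩ := h
    have : walkSign σ (a :: l) = σ a.1 * walkSign σ l := by simp [walkSign]
    rw [this]
    rcases hσ _ ha with h1 | h1 <;> rcases ih hl with h2 | h2 <;> simp [h1, h2]

theorem connRel_refl (v : G.V) : G.connRel S v v := Relation.EqvGen.refl v

theorem connRel_symm {v w : G.V} (h : G.connRel S v w) : G.connRel S w v :=
  Relation.EqvGen.symm _ _ h

theorem connRel_trans {u v w : G.V} (h : G.connRel S u v) (h' : G.connRel S v w) :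
    G.connRel S u w :=
  Relation.EqvGen.trans _ _ _ h h'

theorem connRel_edge {e : G.E} (he : e ∈ S) : G.connRel S (G.o e) (G.t e) :=
  Relation.EqvGen.rel _ _ ⟨e, he, rfl, rfl⟩

theorem component_eq_iff {v w : G.V} :
    G.component S v = G.component S w ↔ G.connRel S v w := by
  constructor
  · intro h
    have : w ∈ G.component S w := connRel_refl w
    rw [← h] at this
    exact this
  · intro h
    ext u
    exact ⟨fun hu => connRel_trans (connRel_symm h) hu, fun hu => connRel_trans h hu⟩

theorem IsWalk.connRel {v w : G.V} {l : List (G.E × Bool)} (h : IsWalk S v w l) :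
    G.connRel S v w := by
  induction l generalizing v with
  | nil => exact h ▸ connRel_refl v
  | cons a l ih =>
    obtain ⟨ha, rfl, hl⟩ := h
    refine connRel_trans ?_ (ih hl)
    rcases a with ⟨e, _ | _⟩
    · exact connRel_symm (connRel_edge ha)
    · exact connRel_edge ha

theorem exists_isWalk_of_connRel {v w : G.V} (h : G.connRel S v w) : ∃ l, IsWalk S v w l := by
  induction h with
  | rel v w h =>
    obtain ⟨e, he, rfl, rfl⟩ := h
    exact ⟨[(e, true)], he, rfl, rfl⟩
  | refl v => exact ⟨[], rfl⟩
  | symm v w _ ih =>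
    obtain ⟨l, hl⟩ := ih
    obtain ⟨l', hl', -⟩ := hl.exists_reverse (σ := fun _ => 1)
    exact ⟨l', hl'⟩
  | trans u v w _ _ ih ih' =>
    obtain ⟨l, hl⟩ := ih
    obtain ⟨l', hl'⟩ := ih'
    exact ⟨l ++ l', isWalk_append.2 ⟨_, hl, hl'⟩⟩

theorem IsWalk.split {v w : G.V} {l : List (G.E × Bool)} (h : IsWalk S v w l) {i : ℕ}
    (hi : i < l.length) :
    IsWalk S v (G.esrc l[i].1 l[i].2) (l.take i) ∧
      IsWalk S (G.esrc l[i].1 l[i].2) w (l.drop i) := by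
  rw [← List.take_append_drop i l, isWalk_append] at h
  obtain ⟨u, h1, h2⟩ := h
  have h3 := h2
  rw [List.drop_eq_getElem_cons hi] at h3
  obtain ⟨-, rfl, -⟩ := h3
  exact ⟨h1, h2⟩

theorem IsWalk.edst_getElem {v : G.V} {l : List (G.E × Bool)} (h : IsWalk S v v l) {i : ℕ}
    (hi : i < l.length) (hi' : (i + 1) % l.length < l.length) :
    G.edst l[i].1 l[i].2 = G.esrc l[(i + 1) % l.length].1 l[(i + 1) % l.length].2 := by
  have h1 := (h.split hi).2
  rw [List.drop_eq_getElem_cons hi] at h1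
  obtain ⟨-, -, h2⟩ := h1
  by_cases hlt : i + 1 < l.length
  · rw [List.drop_eq_getElem_cons hlt] at h2
    simp only [Nat.mod_eq_of_lt hlt]
    exact h2.2.1.symm
  · have heq : i + 1 = l.length := by omega
    rw [heq, List.drop_length] at h2
    have h0 : 0 < l.length := by omega
    have h3 := (h.split h0).1
    simp only [heq, Nat.mod_self]
    rw [List.take_zero] at h3
    exact Eq.trans h2 h3

/-- A closed walk with sign `-1` contains a cycle with sign `-1`. -/
theorem exists_cycle_of_closed_walk (hσ : ∀ e ∈ S, σ e = 1 ∨ σ e = -1)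
    (l : List (G.E × Bool)) : ∀ v, IsWalk S v v l → walkSign σ l = -1 →
    ∃ c : G.Cycle, c.inSub S ∧ ∏ i, σ (c.edge i) = -1 ∧ G.connRel S v c.start := by
  induction hn : l.length using Nat.strong_induction_on generalizing l with
  | _ n ih =>
  subst hn
  intro v hl hs
  by_cases hinj : ∀ i j (hi : i < l.length) (hj : j < l.length), i < j →
      G.esrc l[i].1 l[i].2 ≠ G.esrc l[j].1 l[j].2
  · have hinj' : ∀ i j (hi : i < l.length) (hj : j < l.length),
        G.esrc l[i].1 l[i].2 = G.esrc l[j].1 l[j].2 → i = j := by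
      intro i j hi hj h
      rcases lt_trichotomy i j with h' | h' | h'
      · exact absurd h (hinj i j hi hj h')
      · exact h'
      · exact absurd h.symm (hinj j i hj hi h')
    have hpos : 0 < l.length := by
      rcases l with _ | ⟨a, l⟩
      · simp only [walkSign, List.map_nil, List.prod_nil] at hs
        norm_num at hs
      · simp
    have hedge : ∀ i j (hi : i < l.length) (hj : j < l.length), i < j → l[i].1 ≠ l[j].1 := by
      intro i j hi hj hij he
      by_cases hd : l[i].2 = l[j].2
      · exact hinj i j hi hj hij (by rw [he, hd])
      · have hd' : l[j].2 = !l[i].2 := by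
          revert hd
          cases l[i].2 <;> cases l[j].2 <;> simp
        have e1 : G.esrc l[j].1 l[j].2 = G.edst l[i].1 l[i].2 := by
          rw [hd', ← he, esrc_not]
        have e2 : G.edst l[j].1 l[j].2 = G.esrc l[i].1 l[i].2 := by
          rw [hd', ← he, edst_not]
        have m1 : (i + 1) % l.length < l.length := Nat.mod_lt _ hpos
        have m2 : (j + 1) % l.length < l.length := Nat.mod_lt _ hpos
        rw [hl.edst_getElem hi m1] at e1
        rw [hl.edst_getElem hj m2] at e2
        have f1 := hinj' _ _ hj m1 e1
        have f2 := hinj' _ _ m2 hi e2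
        rw [Nat.mod_eq_of_lt (by omega)] at f1
        have hjl : j + 1 = l.length := by
          by_contra hne
          rw [Nat.mod_eq_of_lt (by omega)] at f2
          omega
        rw [hjl, Nat.mod_self] at f2
        subst f1
        subst f2
        obtain ⟨a, b, rfl⟩ := List.length_eq_two.1 hjl.symm
        simp only [List.getElem_cons_zero, List.getElem_cons_succ] at he
        have ha : a.1 ∈ S := hl.mem a (by simp)
        simp only [walkSign, List.map_cons, List.map_nil, List.prod_cons, List.prod_nil, ← he,
          mul_one] at hs
        rcases hσ _ ha with h | h <;> rw [h] at hs <;> norm_num at hs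
    refine ⟨⟨l.length, hpos, fun i => l[i].1, fun i => l[i].2, ?_, ?_, ?_⟩, ?_, ?_, ?_⟩
    · intro i j h
      rcases lt_trichotomy (i : ℕ) j with h' | h' | h'
      · exact absurd h (hedge i j i.2 j.2 h')
      · exact Fin.ext h'
      · exact absurd h.symm (hedge j i j.2 i.2 h')
    · intro i j h
      exact Fin.ext (hinj' i j i.2 j.2 h)
    · intro i
      exact hl.edst_getElem i.2 _
    · intro i
      exact hl.mem _ (List.getElem_mem _)
    · rw [← hs, walkSign, ← List.prod_ofFn]
      congr 1
      apply List.ext_getElem <;> simp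
    · have h3 := (hl.split hpos).1
      rw [List.take_zero] at h3
      exact h3 ▸ connRel_refl _
  · push Not at hinj
    obtain ⟨i, j, hi, hj, hij, he⟩ := hinj
    obtain ⟨w1, w2⟩ := hl.split hi
    have hk : j - i < (l.drop i).length := by rw [List.length_drop]; omega
    have hgj : (l.drop i)[j - i] = l[j] := by
      rw [List.getElem_drop]
      congr 1
      omega
    obtain ⟨w3, w4⟩ := w2.split hk
    simp only [hgj, ← he] at w3 w4
    have hlist : l = l.take i ++ ((l.drop i).take (j - i) ++ (l.drop i).drop (j - i)) := by
      rw [List.take_append_drop, List.take_append_drop]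
    have hsig : walkSign σ (l.take i ++ (l.drop i).drop (j - i)) *
        walkSign σ ((l.drop i).take (j - i)) = -1 := by
      rw [← hs]
      conv_rhs => rw [hlist]
      simp only [walkSign_append]
      ring
    have w5 : IsWalk S v v (l.take i ++ (l.drop i).drop (j - i)) :=
      isWalk_append.2 ⟨_, w1, w4⟩
    rcases w3.walkSign_eq hσ with h | h
    · rw [h, mul_one] at hsig
      refine ih _ ?_ _ rfl v w5 hsig
      simp only [List.length_append, List.length_take, List.length_drop]
      omega
    · obtain ⟨c, hc1, hc2, hc3⟩ := ih _ (by
        simp only [List.length_take, List.length_drop]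
        omega) _ rfl _ w3 h
      exact ⟨c, hc1, hc2, connRel_trans w1.connRel hc3⟩

theorem walkSign_unique (hσ : ∀ e ∈ S, σ e = 1 ∨ σ e = -1) {v w : G.V}
    (hv : ¬∃ c : G.Cycle, c.inSub S ∧ ∏ i, σ (c.edge i) = -1 ∧ G.connRel S v c.start)
    {l l' : List (G.E × Bool)} (hl : IsWalk S v w l) (hl' : IsWalk S v w l') :
    walkSign σ l = walkSign σ l' := by
  obtain ⟨r, hr, hrs⟩ := hl'.exists_reverse (σ := σ)
  have hclosed : IsWalk S v v (l ++ r) := isWalk_append.2 ⟨_, hl, hr⟩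
  have hne : walkSign σ (l ++ r) ≠ -1 := fun h =>
    hv (exists_cycle_of_closed_walk hσ _ v hclosed h)
  rw [walkSign_append, hrs] at hne
  rcases hl.walkSign_eq hσ with h | h <;> rcases hl'.walkSign_eq hσ with h' | h' <;>
    simp [h, h'] at hne ⊢

theorem eq_zero_iff_of_connRel (hσ : ∀ e ∈ S, σ e = 1 ∨ σ e = -1) {y : G.V → ℂ}
    (hy : ∀ e ∈ S, σ e * y (G.t e) = y (G.o e)) {v w : G.V} (h : G.connRel S v w) :
    y v = 0 ↔ y w = 0 := by
  induction h with
  | rel v w h =>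
    obtain ⟨e, he, rfl, rfl⟩ := h
    rw [← hy e he]
    rcases hσ e he with h | h <;> simp [h]
  | refl v => rfl
  | symm v w _ ih => exact ih.symm
  | trans u v w _ _ ih ih' => exact ih.trans ih'

theorem Cycle.connRel_src (c : G.Cycle) (hc : c.inSub S) (k : ℕ) (hk : k < c.n) :
    G.connRel S c.start (G.esrc (c.edge ⟨k, hk⟩) (c.dir ⟨k, hk⟩)) := by
  induction k with
  | zero => exact connRel_refl _
  | succ k ih =>
    have hk' : k < c.n := by omega
    refine connRel_trans (ih hk') ?_
    have h := c.chain ⟨k, hk'⟩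
    simp only [Nat.mod_eq_of_lt hk] at h
    rw [← h]
    have : IsWalk S (G.esrc (c.edge ⟨k, hk'⟩) (c.dir ⟨k, hk'⟩))
        (G.edst (c.edge ⟨k, hk'⟩) (c.dir ⟨k, hk'⟩)) [(c.edge ⟨k, hk'⟩, c.dir ⟨k, hk'⟩)] :=
      ⟨hc _, rfl, rfl⟩
    exact this.connRel

theorem Cycle.start_eq_zero (hσ : ∀ e ∈ S, σ e = 1 ∨ σ e = -1) {y : G.V → ℂ}
    (hy : ∀ e ∈ S, σ e * y (G.t e) = y (G.o e)) (c : G.Cycle) (hc : c.inSub S)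
    (hodd : ∏ i, σ (c.edge i) = -1) : y c.start = 0 := by
  have hstep : ∀ e ∈ S, ∀ d, y (G.esrc e d) = σ e * y (G.edst e d) := by
    intro e he d
    cases d
    · have := hy e he
      rcases hσ e he with h | h <;> rw [h] at this ⊢ <;> simp [esrc, edst, ← this]
    · exact (hy e he).symm
  set next : Fin c.n → Fin c.n := fun i => ⟨((i : ℕ) + 1) % c.n, Nat.mod_lt _ c.npos⟩
  have hbij : Function.Bijective next := by
    refine Function.Injective.bijective_of_finite fun i j h => ?_
    have h1 : ((i : ℕ) + 1) % c.n = ((j : ℕ) + 1) % c.n := congrArg Fin.val h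
    have h2 : (i : ℕ) ≡ j [MOD c.n] := Nat.ModEq.add_right_cancel' 1 h1
    exact Fin.ext (h2.eq_of_lt_of_lt i.2 j.2)
  have hprod : ∏ i, y (G.esrc (c.edge i) (c.dir i)) =
      -∏ i, y (G.esrc (c.edge i) (c.dir i)) := by
    conv_rhs => rw [← hbij.prod_comp fun i => y (G.esrc (c.edge i) (c.dir i))]
    rw [← neg_one_mul, ← hodd, ← Finset.prod_mul_distrib]
    refine Finset.prod_congr rfl fun i _ => ?_
    rw [hstep _ (hc i), c.chain i]
  have h0 : ∏ i, y (G.esrc (c.edge i) (c.dir i)) = 0 := self_eq_neg.1 hprod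
  obtain ⟨i, -, hi⟩ := Finset.prod_eq_zero_iff.1 h0
  exact (eq_zero_iff_of_connRel hσ hy (c.connRel_src hc i i.2)).2 hi

end MetricGraph

namespace MetricGraph

open scoped Matrix Classical

variable {G : MetricGraph} (S : Set G.E) (σ : G.E → ℂ)

/-- The signed incidence matrix of the subgraph with edge set `S`. -/
def signedIncidence : Matrix (G.incVerts S) S ℂ :=
  Matrix.of fun v e => (if G.t e = v then σ e else 0) - if G.o e = v then 1 else 0

variable {S σ}

theorem transpose_mulVec_apply (y : G.V → ℂ) (e : S) :
    ((signedIncidence S σ)ᵀ *ᵥ fun v => y v) e = σ e * y (G.t e) - y (G.o e) := by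
  have ht : G.t e ∈ G.incVerts S := ⟨e, e.2, Or.inr rfl⟩
  have ho : G.o e ∈ G.incVerts S := ⟨e, e.2, Or.inl rfl⟩
  simp only [Matrix.mulVec, dotProduct, Matrix.transpose_apply, signedIncidence, Matrix.of_apply,
    sub_mul, Finset.sum_sub_distrib]
  rw [Finset.sum_eq_single ⟨G.t e, ht⟩, Finset.sum_eq_single ⟨G.o e, ho⟩]
  · simp
  · intro v _ hv
    rw [if_neg fun h => hv (Subtype.ext h.symm), zero_mul]
  · simp
  · intro v _ hv
    rw [if_neg fun h => hv (Subtype.ext h.symm), zero_mul]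
  · simp

theorem finrank_ker_signedIncidence_add :
    Module.finrank ℂ (LinearMap.ker (signedIncidence S σ).mulVecLin) + (G.incVerts S).ncard =
      S.ncard + Module.finrank ℂ (LinearMap.ker (signedIncidence S σ)ᵀ.mulVecLin) := by
  have h1 := LinearMap.finrank_range_add_finrank_ker (signedIncidence S σ).mulVecLin
  have h2 := LinearMap.finrank_range_add_finrank_ker (signedIncidence S σ)ᵀ.mulVecLin
  have h3 := Matrix.rank_transpose (signedIncidence S σ)
  rw [Matrix.rank, Matrix.rank] at h3
  rw [Module.finrank_fintype_fun_eq_card, Fintype.card_eq_nat_card, Nat.card_coe_set_eq] at h1 h2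
  omega

/-- The vertices of `S` whose component contains a cycle of sign `-1`. -/
def oddVerts (S : Set G.E) (σ : G.E → ℂ) : Set G.V := {v | v ∈ G.incVerts S ∧
  ∃ c : G.Cycle, c.inSub S ∧ ∏ i, σ (c.edge i) = -1 ∧ G.connRel S v c.start}

theorem component_mem_diff_iff {v : G.V} (hv : v ∈ G.incVerts S) :
    G.component S v ∈ G.component S '' G.incVerts S \ G.component S '' oddVerts S σ ↔
      ¬∃ c : G.Cycle, c.inSub S ∧ ∏ i, σ (c.edge i) = -1 ∧ G.connRel S v c.start := by
  constructor
  · rintro ⟨-, h⟩ hc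
    exact h ⟨v, ⟨hv, hc⟩, rfl⟩
  · intro h
    refine ⟨⟨v, hv, rfl⟩, ?_⟩
    rintro ⟨w, ⟨-, c, h1, h2, h3⟩, hw⟩
    exact h ⟨c, h1, h2, connRel_trans (connRel_symm (component_eq_iff.1 hw)) h3⟩

theorem finrank_ker_transpose (hσ : ∀ e ∈ S, σ e = 1 ∨ σ e = -1) :
    Module.finrank ℂ (LinearMap.ker (signedIncidence S σ)ᵀ.mulVecLin) =
      (G.component S '' G.incVerts S \ G.component S '' oddVerts S σ).ncard := by
  set C := G.component S '' G.incVerts S \ G.component S '' oddVerts S σ with hC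
  choose rep hrep hcomp using fun c : C => c.2.1
  let Φ : LinearMap.ker (signedIncidence S σ)ᵀ.mulVecLin →ₗ[ℂ] (C → ℂ) :=
    (LinearMap.funLeft ℂ ℂ fun c : C => (⟨rep c, hrep c⟩ : G.incVerts S)).comp
      (Submodule.subtype _)
  have hodd : ∀ c : C, ¬∃ d : G.Cycle, d.inSub S ∧ ∏ i, σ (d.edge i) = -1 ∧
      G.connRel S (rep c) d.start := fun c => by
    rw [← component_mem_diff_iff (hrep c), hcomp c]
    exact c.2
  have hinj : Function.Injective Φ := by
    rw [← LinearMap.ker_eq_bot, LinearMap.ker_eq_bot']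
    rintro ⟨y, hy⟩ h
    set y' : G.V → ℂ := fun v => if hv : v ∈ G.incVerts S then y ⟨v, hv⟩ else 0 with hy'
    have hyy : y = fun v : G.incVerts S => y' v := by
      funext v
      simp [hy']
    have hrel : ∀ e ∈ S, σ e * y' (G.t e) = y' (G.o e) := fun e he => by
      have := congrFun (LinearMap.mem_ker.1 hy) ⟨e, he⟩
      rw [Matrix.mulVecLin_apply, hyy, transpose_mulVec_apply] at this
      exact sub_eq_zero.1 this
    refine Subtype.ext (funext fun v => ?_)
    rw [ZeroMemClass.coe_zero, Pi.zero_apply]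
    change y v = 0
    rw [hyy]
    change y' v = 0
    by_cases hv : ∃ c : G.Cycle, c.inSub S ∧ ∏ i, σ (c.edge i) = -1 ∧ G.connRel S v c.start
    · obtain ⟨c, h1, h2, h3⟩ := hv
      exact (eq_zero_iff_of_connRel hσ hrel h3).2 (c.start_eq_zero hσ hrel h1 h2)
    · have hvC := (component_mem_diff_iff v.2).2 hv
      have h0 : y ⟨rep ⟨_, hvC⟩, hrep _⟩ = 0 := congrFun h ⟨_, hvC⟩
      rw [hyy] at h0
      exact (eq_zero_iff_of_connRel hσ hrel (component_eq_iff.1 (hcomp ⟨_, hvC⟩))).1 h0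
  have hsurj : Function.Surjective Φ := by
    intro z
    have hwalk : ∀ v, ∃ s : ℂ, ∀ hv : G.component S v ∈ C,
        ∃ l, IsWalk S (rep ⟨_, hv⟩) v l ∧ walkSign σ l = s := fun v => by
      by_cases hv : G.component S v ∈ C
      · obtain ⟨l, hl⟩ := exists_isWalk_of_connRel (component_eq_iff.1 (hcomp ⟨_, hv⟩))
        exact ⟨_, fun _ => ⟨l, hl, rfl⟩⟩
      · exact ⟨0, fun h => absurd h hv⟩
    choose s hs using hwalk
    set y : G.V → ℂ := fun v => if hv : G.component S v ∈ C then s v * z ⟨_, hv⟩ else 0 with hy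
    have hrel : ∀ e ∈ S, σ e * y (G.t e) = y (G.o e) := fun e he => by
      have hot := component_eq_iff.2 (connRel_edge he)
      by_cases hv : G.component S (G.o e) ∈ C
      · have hv' : G.component S (G.t e) ∈ C := hot ▸ hv
        have hcc : (⟨_, hv⟩ : C) = ⟨_, hv'⟩ := Subtype.ext hot
        simp only [hy, dif_pos hv, dif_pos hv', hcc]
        obtain ⟨l, hl, hls⟩ := hs _ hv
        obtain ⟨l', hl', hls'⟩ := hs _ hv'
        rw [hcc] at hl
        have hl2 : IsWalk S (rep ⟨_, hv'⟩) (G.t e) (l ++ [(e, true)]) :=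
          isWalk_append.2 ⟨_, hl, he, rfl, rfl⟩
        have := walkSign_unique hσ (hodd _) hl2 hl'
        rw [walkSign_append, hls, hls'] at this
        have h1 : walkSign σ [(e, true)] = σ e := by simp [walkSign]
        rw [h1] at this
        have h2 : σ e * σ e = 1 := by rcases hσ e he with h | h <;> simp [h]
        rw [← this]
        linear_combination s (G.o e) * z ⟨_, hv'⟩ * h2
      · have hv' : G.component S (G.t e) ∉ C := hot ▸ hv
        simp only [hy, dif_neg hv, dif_neg hv', mul_zero]
    refine ⟨⟨fun v => y v, LinearMap.mem_ker.2 (funext fun e => ?_)⟩, funext fun c => ?_⟩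
    · rw [Matrix.mulVecLin_apply, transpose_mulVec_apply, hrel e e.2, sub_self]
      rfl
    · change y (rep c) = z c
      have hv : G.component S (rep c) ∈ C := by rw [hcomp]; exact c.2
      have hcc : (⟨_, hv⟩ : C) = c := Subtype.ext (hcomp c)
      simp only [hy, dif_pos hv, hcc]
      obtain ⟨l, hl, hls⟩ := hs _ hv
      rw [hcc] at hl
      rw [← hls, walkSign_unique hσ (hodd c) hl (l' := []) rfl]
      simp [walkSign]
  rw [(LinearEquiv.ofBijective Φ ⟨hinj, hsurj⟩).finrank_eq, Module.finrank_fintype_fun_eq_card,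
    Fintype.card_eq_nat_card, Nat.card_coe_set_eq]

theorem finrank_ker_signedIncidence (hσ : ∀ e ∈ S, σ e = 1 ∨ σ e = -1) :
    (Module.finrank ℂ (LinearMap.ker (signedIncidence S σ).mulVecLin) : ℤ) =
      G.beta1 S - (G.component S '' oddVerts S σ).ncard := by
  have h1 := finrank_ker_signedIncidence_add (S := S) (σ := σ)
  have hsub : G.component S '' oddVerts S σ ⊆ G.component S '' G.incVerts S :=
    Set.image_mono fun v hv => hv.1
  have h2 := Set.ncard_sdiff_add_ncard_of_subset hsub (Set.toFinite _)
  rw [finrank_ker_transpose hσ] at h1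
  rw [beta1, beta0]
  omega

end MetricGraph

namespace MetricGraph

open scoped Matrix Classical

variable {G : MetricGraph}

/-- The value of `cos (√λ s)` at the end of an edge. -/
def edgeSign (G : MetricGraph) (lam : ℝ) (e : G.E) : ℂ := Complex.cos ((√lam : ℝ) * (G.L e : ℂ))

theorem edgeSign_eq_pow {lam : ℝ} (hlam : 0 < lam) {e : G.E} {k : ℕ}
    (hk : G.L e = k * (π / √lam)) : G.edgeSign lam e = (-1) ^ k := by
  have h : √lam * G.L e = k * π := by
    rw [hk]
    field_simp
  rw [edgeSign, ← Complex.ofReal_mul, h, ← Complex.ofReal_cos, Real.cos_nat_mul_pi]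
  push_cast
  rfl

theorem edgeSign_eq {lam : ℝ} (hlam : 0 < lam) (e : G.E) (he : e ∈ G.lamEdges lam) :
    G.edgeSign lam e = 1 ∨ G.edgeSign lam e = -1 := by
  obtain ⟨k, -, hk⟩ := he
  rw [edgeSign_eq_pow hlam hk]
  exact neg_one_pow_eq_or ℂ k

theorem sin_eq_zero_iff_mem_lamEdges {lam : ℝ} (hlam : 0 < lam) (e : G.E) :
    Complex.sin ((√lam : ℝ) * (G.L e : ℂ)) = 0 ↔ e ∈ G.lamEdges lam := by
  have hω : 0 < √lam := Real.sqrt_pos.2 hlam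
  rw [← Complex.ofReal_mul, ← Complex.ofReal_sin, Complex.ofReal_eq_zero, Real.sin_eq_zero_iff]
  constructor
  · rintro ⟨n, hn⟩
    have hpos : 0 < (n : ℝ) * π := hn ▸ mul_pos hω (G.L_pos e)
    have hn0 : 0 < n := by exact_mod_cast pos_of_mul_pos_left hpos Real.pi_pos.le
    lift n to ℕ using hn0.le
    refine ⟨n, by exact_mod_cast hn0, ?_⟩
    rw [← mul_div_assoc, eq_div_iff hω.ne', mul_comm (G.L e), ← hn, Int.cast_natCast]
  · rintro ⟨k, -, hk⟩
    refine ⟨k, ?_⟩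
    rw [hk]
    field_simp
    simp

theorem Cycle.oddLength_iff {lam : ℝ} (hlam : 0 < lam) (c : G.Cycle)
    (hc : c.inSub (G.lamEdges lam)) :
    c.oddLength (π / √lam) ↔ ∏ i, G.edgeSign lam (c.edge i) = -1 := by
  choose k hk0 hk using hc
  have hlen : c.length = (∑ i, k i : ℕ) * (π / √lam) := by
    rw [Cycle.length, Nat.cast_sum, Finset.sum_mul]
    exact Finset.sum_congr rfl fun i _ => hk i
  have hx : π / √lam ≠ 0 := (div_pos Real.pi_pos (Real.sqrt_pos.2 hlam)).ne'
  rw [Finset.prod_congr rfl fun i _ => edgeSign_eq_pow hlam (hk i), Finset.prod_pow_eq_pow_sum,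
    neg_one_pow_eq_neg_one_iff_odd (by norm_num : (-1 : ℂ) ≠ 1)]
  constructor
  · rintro ⟨m, hm, h⟩
    rw [hlen] at h
    have := mul_right_cancel₀ hx h
    rwa [Nat.cast_injective this]
  · exact fun h => ⟨_, h, hlen⟩

theorem beta0odd_lamEdges {lam : ℝ} (hlam : 0 < lam) :
    G.beta0odd (G.lamEdges lam) (π / √lam) =
      (G.component (G.lamEdges lam) '' oddVerts (G.lamEdges lam) (G.edgeSign lam)).ncard := by
  rw [beta0odd]
  congr 2
  ext v
  refine and_congr_right fun _ => exists_congr fun c => and_congr_right fun hc => ?_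
  rw [c.oddLength_iff hlam hc]

theorem normDer_trig_of_vertices_eq_zero {lam : ℝ} {x : G.E ⊕ G.V → ℂ}
    (h0 : ∀ v, x (Sum.inr v) = 0) (v : G.V) :
    G.normDer (G.trig (√lam : ℝ) x) v = (√lam : ℝ) * ∑ e,
      ((if G.t e = v then G.edgeSign lam e else 0) - if G.o e = v then 1 else 0) *
        x (Sum.inl e) := by
  simp only [normDer_trig, trigDer, h0, zero_mul, sub_zero, Complex.ofReal_zero, mul_zero,
    Complex.cos_zero, mul_one, Finset.sum_filter, ← Finset.sum_sub_distrib, Finset.mul_sum]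
  refine Finset.sum_congr rfl fun e _ => ?_
  rw [edgeSign]
  split_ifs <;> ring

theorem signedIncidence_mulVec {S : Set G.E} {σ b : G.E → ℂ} (hb : ∀ e ∉ S, b e = 0)
    (v : G.incVerts S) :
    (signedIncidence S σ *ᵥ fun e => b e) v =
      ∑ e, ((if G.t e = v then σ e else 0) - if G.o e = v then 1 else 0) * b e := by
  refine Eq.trans (Finset.sum_set_coe S (f := fun e =>
    ((if G.t e = v then σ e else 0) - if G.o e = v then 1 else 0) * b e)) ?_
  refine Finset.sum_subset (Finset.subset_univ _) fun e _ he => ?_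
  rw [hb e (by simpa using he), mul_zero]

theorem mem_kerVanishing_univ_iff {lam : ℝ} (hlam : 0 < lam) (x : G.E ⊕ G.V → ℂ) :
    x ∈ G.kerVanishing (√lam : ℝ) Finset.univ ↔ (∀ v, x (Sum.inr v) = 0) ∧
      (∀ e ∉ G.lamEdges lam, x (Sum.inl e) = 0) ∧
      signedIncidence (G.lamEdges lam) (G.edgeSign lam) *ᵥ (fun e => x (Sum.inl e)) = 0 := by
  have hω : ((√lam : ℝ) : ℂ) ≠ 0 := Complex.ofReal_ne_zero.2 (Real.sqrt_pos.2 hlam).ne'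
  rw [kerVanishing, Submodule.mem_inf, LinearMap.mem_ker, LinearMap.mem_ker]
  constructor
  · rintro ⟨h1, h2⟩
    have h0 : ∀ v, x (Sum.inr v) = 0 := fun v => congrFun h2 ⟨v, Finset.mem_univ v⟩
    have hb : ∀ e ∉ G.lamEdges lam, x (Sum.inl e) = 0 := fun e he => by
      have := congrFun h1 (Sum.inl e)
      rw [vertexMap_inl, trig, h0, h0, zero_mul, zero_add, sub_zero, Pi.zero_apply] at this
      exact (mul_eq_zero.1 this).resolve_right (mt (sin_eq_zero_iff_mem_lamEdges hlam e).1 he)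
    refine ⟨h0, hb, funext fun v => ?_⟩
    rw [signedIncidence_mulVec (b := fun e => x (Sum.inl e)) hb]
    have := congrFun h1 (Sum.inr v)
    rw [vertexMap_inr, normDer_trig_of_vertices_eq_zero h0] at this
    exact (mul_eq_zero.1 this).resolve_left hω
  · rintro ⟨h0, hb, h⟩
    refine ⟨funext ?_, funext fun v => h0 v⟩
    rintro (e | v)
    · rw [vertexMap_inl, trig, h0, h0, zero_mul, zero_add, sub_zero, Pi.zero_apply]
      by_cases he : e ∈ G.lamEdges lam
      · rw [(sin_eq_zero_iff_mem_lamEdges hlam e).2 he, mul_zero]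
      · rw [hb e he, zero_mul]
    · rw [vertexMap_inr, normDer_trig_of_vertices_eq_zero h0, Pi.zero_apply]
      by_cases hv : v ∈ G.incVerts (G.lamEdges lam)
      · have := congrFun h ⟨v, hv⟩
        rw [signedIncidence_mulVec (b := fun e => x (Sum.inl e)) hb] at this
        rw [this, Pi.zero_apply, mul_zero]
      · rw [Finset.sum_eq_zero, mul_zero]
        intro e _
        by_cases he : e ∈ G.lamEdges lam
        · rw [if_neg fun h => hv ⟨e, he, Or.inr h⟩, if_neg fun h => hv ⟨e, he, Or.inl h⟩,
            sub_zero, zero_mul]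
        · rw [hb e he, mul_zero]

theorem finrank_kerVanishing_univ {lam : ℝ} (hlam : 0 < lam) :
    (Module.finrank ℂ (G.kerVanishing (√lam : ℝ) Finset.univ) : ℤ) =
      G.beta1 (G.lamEdges lam) - G.beta0odd (G.lamEdges lam) (π / √lam) := by
  rw [beta0odd_lamEdges hlam, ← finrank_ker_signedIncidence (edgeSign_eq hlam)]
  let Φ : G.kerVanishing (√lam : ℝ) Finset.univ →ₗ[ℂ] LinearMap.ker
      (signedIncidence (G.lamEdges lam) (G.edgeSign lam)).mulVecLin :=
    LinearMap.codRestrict _ ((LinearMap.funLeft ℂ ℂ fun e : G.lamEdges lam =>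
      (Sum.inl (e : G.E) : G.E ⊕ G.V)).comp (Submodule.subtype _)) fun x =>
        ((mem_kerVanishing_univ_iff hlam _).1 x.2).2.2
  have hinj : Function.Injective Φ := by
    rw [← LinearMap.ker_eq_bot, LinearMap.ker_eq_bot']
    rintro ⟨x, hx⟩ h
    obtain ⟨h1, h2, -⟩ := (mem_kerVanishing_univ_iff hlam x).1 hx
    refine Subtype.ext (funext ?_)
    rintro (e | v)
    · by_cases he : e ∈ G.lamEdges lam
      · exact congrFun (congrArg Subtype.val h) ⟨e, he⟩
      · exact h2 e he
    · exact h1 v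
  have hsurj : Function.Surjective Φ := by
    rintro ⟨b, hb⟩
    refine ⟨⟨Sum.elim (fun e => if he : e ∈ G.lamEdges lam then b ⟨e, he⟩ else 0) fun _ => 0,
      (mem_kerVanishing_univ_iff hlam _).2 ⟨fun v => rfl, fun e he => ?_, ?_⟩⟩, ?_⟩
    · simp [he]
    · rw [← LinearMap.mem_ker.1 hb, Matrix.mulVecLin_apply]
      congr 1
      funext e
      simp
    · refine Subtype.ext (funext fun e => ?_)
      change (if he : (e : G.E) ∈ G.lamEdges lam then b ⟨e, he⟩ else 0) = b e
      rw [dif_pos e.2]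
  rw [(LinearEquiv.ofBijective Φ ⟨hinj, hsurj⟩).finrank_eq]

/-- The edgewise function with given coefficients, as a linear map. -/
def trigLin (G : MetricGraph) (ω : ℂ) : (G.E ⊕ G.V → ℂ) →ₗ[ℂ] (G.E → ℝ → ℂ) where
  toFun := G.trig ω
  map_add' x y := by
    funext e s
    exact G.trig_add ω x y e s
  map_smul' c x := by
    funext e s
    exact G.trig_smul ω c x e s

theorem kerSet_eq {lam : ℝ} (hlam : 0 < lam) :
    G.kerSet lam =
      Submodule.map (G.trigLin (√lam : ℝ)) (LinearMap.ker (G.vertexMap (√lam : ℝ))) := by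
  have hω : ((√lam : ℝ) : ℂ) ≠ 0 := Complex.ofReal_ne_zero.2 (Real.sqrt_pos.2 hlam).ne'
  have hsq : (lam : ℂ) = ((√lam : ℝ) : ℂ) ^ 2 := by
    rw [← Complex.ofReal_pow, Real.sq_sqrt hlam.le]
  ext f
  rw [kerSet, Set.mem_ofPred_eq, InKer, hsq, SetLike.mem_coe, Submodule.mem_map]
  constructor
  · rintro ⟨hf, hn⟩
    obtain ⟨x, rfl, hx⟩ := hf.exists_trig hω
    refine ⟨x, LinearMap.mem_ker.2 (funext ?_), rfl⟩
    rintro (e | v)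
    · exact hx e
    · exact hn v
  · rintro ⟨x, hx, rfl⟩
    exact ⟨isSol_trig fun e => congrFun hx (Sum.inl e), fun v => congrFun hx (Sum.inr v)⟩

theorem dimKer_eq {lam : ℝ} (hlam : 0 < lam) :
    G.dimKer lam = Module.finrank ℂ (LinearMap.ker (G.vertexMap (√lam : ℝ))) := by
  have hω : ((√lam : ℝ) : ℂ) ≠ 0 := Complex.ofReal_ne_zero.2 (Real.sqrt_pos.2 hlam).ne'
  have hinj : Function.Injective
      ((G.trigLin (√lam : ℝ)).domRestrict (LinearMap.ker (G.vertexMap (√lam : ℝ)))) := by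
    rw [← LinearMap.ker_eq_bot, LinearMap.ker_eq_bot']
    rintro ⟨x, hx⟩ h
    have hx0 : G.trig (√lam : ℝ) x = 0 := h
    have hco : ∀ e, x (Sum.inr (G.o e)) = 0 ∧ x (Sum.inl e) = 0 := fun e => by
      refine trig_coeff_eq_zero hω (s := 0) ?_ ?_
      · rw [hx0]
        rfl
      · rw [← deriv_trig, hx0]
        exact deriv_const _ _
    refine Subtype.ext (funext ?_)
    rintro (e | v)
    · exact (hco e).2
    · obtain ⟨e, rfl | rfl⟩ := G.noIsolated v
      · exact (hco e).1
      · have := congrFun hx (Sum.inl e)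
        rw [vertexMap_inl, hx0] at this
        exact (sub_eq_zero.1 this).symm
  rw [dimKer, kerSet_eq hlam, Submodule.span_eq, ← LinearMap.range_domRestrict,
    LinearMap.finrank_range_of_inj hinj]

theorem isEigenvalue_of_dimKer_pos {lam : ℝ} (h : 0 < G.dimKer lam) : G.IsEigenvalue lam := by
  intro h0
  rw [dimKer, h0, Submodule.span_zero_singleton, finrank_bot] at h
  exact absurd h (lt_irrefl 0)

end MetricGraph

/-- Theorem `thm:visibility` (ii): if `B` contains all boundary
vertices and all proper core vertices, `λ > 0`, and `β₁(G_λ) > β₀^odd(G_λ)`, then `λ`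
is an eigenvalue of `-Δ_G`,
`dim ker(-Δ_G - λ) = rank Res_λ M_B + β₁(G_λ) - β₀^odd(G_λ)`, and `λ` is a pole of
`M_B` iff `dim ker(-Δ_G - λ) > β₁(G_λ) - β₀^odd(G_λ)`. -/
theorem statement_14 (G : MetricGraph) (B : Finset G.V)
    (hbd : ∀ v, G.IsBoundaryVertex v → v ∈ B)
    (hcore : ∀ v, G.IsProperCoreVertex v → v ∈ B)
    (lam : ℝ) (hlam : 0 < lam)
    (hbetti : (G.beta0odd (G.lamEdges lam) (π / Real.sqrt lam) : ℤ) <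
      G.beta1 (G.lamEdges lam)) :
    G.IsEigenvalue lam ∧
    (G.dimKer lam : ℤ) = ((matResidue (G.TW B) (lam : ℂ)).rank : ℤ) +
      G.beta1 (G.lamEdges lam) - (G.beta0odd (G.lamEdges lam) (π / Real.sqrt lam) : ℤ) ∧
    (isPole (G.TW B) (lam : ℂ) ↔
      G.beta1 (G.lamEdges lam) - (G.beta0odd (G.lamEdges lam) (π / Real.sqrt lam) : ℤ) <
        (G.dimKer lam : ℤ)) := by
  obtain ⟨A, H, hH, hM, hrank⟩ := G.exists_TW_residue B hlam
  rw [matResidue_eq hH hM, isPole_iff hH hM]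
  have hω : ((√lam : ℝ) : ℂ) ≠ 0 := Complex.ofReal_ne_zero.2 (Real.sqrt_pos.2 hlam).ne'
  have hres := MetricGraph.finrank_kerVanishing_univ (G := G) hlam
  rw [← MetricGraph.dimKer_eq hlam, MetricGraph.kerVanishing_eq hbd hcore hω] at hrank
  have hA : A ≠ 0 ↔ 0 < A.rank := by
    rw [Nat.pos_iff_ne_zero, ne_eq, ne_eq, matrix_rank_eq_zero_iff]
  refine ⟨MetricGraph.isEigenvalue_of_dimKer_pos ?_, ?_, ?_⟩
  · omega
  · omega
  · rw [hA]
    omega
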